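/- Let d ≥ 1 and let μ be a compactly supported positive finite Borel measure on ℝ^d satisfying the Fourier decay condition |μ̂(ξ)| ≤ C|ξ|^{−a} for all ξ ≠ 0 with a > 1/2, and the Frostman condition μ(B(x,r)) ≤ C r^b for all x ∈ ℝ^d and r > 0, with d − 1 < b ≤ d. Then for every p > p_{(a,b)} = (2(d−b)+2a−1)/(d−b+2a−1) there is a constant C' such that ‖M_μ f‖_{L^p(ℝ^d)} ≤ C' ‖f‖_{L^p(ℝ^d)} for every Schwartz function f on ℝ^d. -/

import Mathlib

open MeasureTheory Real Set Metric FourierTransform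
open scoped ENNReal NNReal RealInnerProductSpace

noncomputable section

variable {d : ℕ}

/-- Fourier transform of a finite Borel measure on ℝ^d:  μ̂(ξ) = ∫ e^{−2πi x·ξ} dμ(x). -/
def mFT (μ : Measure (EuclideanSpace ℝ (Fin d))) (ξ : EuclideanSpace ℝ (Fin d)) : ℂ :=
  ∫ x, Complex.exp (-(2 * (π : ℂ) * Complex.I * ((⟪x, ξ⟫ : ℝ) : ℂ))) ∂μ

/-- Convolution with the dilated measure: (f ∗ μ_t)(x) = ∫ f(x − t y) dμ(y). -/
def convM (f : EuclideanSpace ℝ (Fin d) → ℂ) (μ : Measure (EuclideanSpace ℝ (Fin d)))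
    (t : ℝ) (x : EuclideanSpace ℝ (Fin d)) : ℂ :=
  ∫ y, f (x - t • y) ∂μ

/-- Global maximal function M_μ f(x) = sup_{t>0} |(f ∗ μ_t)(x)|. -/
def Mmax (μ : Measure (EuclideanSpace ℝ (Fin d))) (f : EuclideanSpace ℝ (Fin d) → ℂ)
    (x : EuclideanSpace ℝ (Fin d)) : ℝ≥0∞ :=
  ⨆ t : {t : ℝ // 0 < t}, (‖convM f μ t x‖₊ : ℝ≥0∞)

/-- Local maximal function M_μ^{loc} f(x) = sup_{t∈[1,2]} |(f ∗ μ_t)(x)|. -/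
def MmaxLoc (μ : Measure (EuclideanSpace ℝ (Fin d))) (f : EuclideanSpace ℝ (Fin d) → ℂ)
    (x : EuclideanSpace ℝ (Fin d)) : ℝ≥0∞ :=
  ⨆ t : (Icc (1:ℝ) 2), (‖convM f μ t x‖₊ : ℝ≥0∞)

/-- L^p norm (in lintegral form) of an ℝ≥0∞-valued function on ℝ^d. -/
def lpE (g : EuclideanSpace ℝ (Fin d) → ℝ≥0∞) (p : ℝ) : ℝ≥0∞ :=
  (∫⁻ x, g x ^ p) ^ (1 / p)

/-- Weak L^q quasinorm of an ℝ≥0∞-valued function on ℝ^d. -/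
def wlpE (g : EuclideanSpace ℝ (Fin d) → ℝ≥0∞) (q : ℝ) : ℝ≥0∞ :=
  ⨆ l : ℝ≥0, (l : ℝ≥0∞) * (volume {x | (l : ℝ≥0∞) < g x}) ^ (1 / q)

/-- Lorentz L^{p,1} norm (up to a constant factor p) of a complex-valued function. -/
def lorentz1 (f : EuclideanSpace ℝ (Fin d) → ℂ) (p : ℝ) : ℝ≥0∞ :=
  ∫⁻ l in Ioi (0:ℝ), (volume {x | l < ‖f x‖}) ^ (1 / p)

/-- Lorentz L^{p,r} quasinorm of a real-valued function,
‖f‖_{p,r} = ( ∫_0^∞ (λ · d_f(λ)^{1/p})^r dλ/λ )^{1/r}. -/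
def lorentzR (f : EuclideanSpace ℝ (Fin d) → ℝ) (p r : ℝ) : ℝ≥0∞ :=
  (∫⁻ l in Ioi (0:ℝ),
      (ENNReal.ofReal l * (volume {x | l < |f x|}) ^ (1 / p)) ^ r / ENNReal.ofReal l) ^ (1 / r)

/-- Littlewood–Paley projection P_k for k ∈ ℤ: (P_k f)^(ξ) = β(2^{−k}|ξ|) f̂(ξ). -/
def Pproj (β : ℝ → ℝ) (k : ℤ) (f : EuclideanSpace ℝ (Fin d) → ℂ)
    (x : EuclideanSpace ℝ (Fin d)) : ℂ :=
  ∫ ξ, Complex.exp (2 * (π : ℂ) * Complex.I * ((⟪x, ξ⟫ : ℝ) : ℂ)) *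
    ((β ((2:ℝ) ^ (-k) * ‖ξ‖) : ℝ) : ℂ) * 𝓕 f ξ

/-- The multiplier operator T_j^t, with multiplier m_j(tξ) = μ̂(tξ) β(2^{−j}|tξ|). -/
def Tj (μ : Measure (EuclideanSpace ℝ (Fin d))) (β : ℝ → ℝ) (j : ℕ) (t : ℝ)
    (f : EuclideanSpace ℝ (Fin d) → ℂ) (x : EuclideanSpace ℝ (Fin d)) : ℂ :=
  ∫ ξ, Complex.exp (2 * (π : ℂ) * Complex.I * ((⟪x, ξ⟫ : ℝ) : ℂ)) *
    (((β ((2:ℝ) ^ (-(j:ℤ)) * ‖t • ξ‖) : ℝ) : ℂ) * mFT μ (t • ξ)) * 𝓕 f ξ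

/-- The maximal multiplier operator T_j^* f(x) = sup_{t>0} |T_j^t f(x)|. -/
def TjStar (μ : Measure (EuclideanSpace ℝ (Fin d))) (β : ℝ → ℝ) (j : ℕ)
    (f : EuclideanSpace ℝ (Fin d) → ℂ) (x : EuclideanSpace ℝ (Fin d)) : ℝ≥0∞ :=
  ⨆ t : {t : ℝ // 0 < t}, (‖Tj μ β j t f x‖₊ : ℝ≥0∞)

/-- M_j f(x) = sup_{k∈ℤ} sup_{2^{−k} ≤ t < 2^{−k+1}} |(P_{k+j} f ∗ μ_t)(x)|. -/
def Mj (μ : Measure (EuclideanSpace ℝ (Fin d))) (β : ℝ → ℝ) (j : ℕ)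
    (f : EuclideanSpace ℝ (Fin d) → ℂ) (x : EuclideanSpace ℝ (Fin d)) : ℝ≥0∞ :=
  ⨆ k : ℤ, ⨆ t : (Ico ((2:ℝ) ^ (-k)) ((2:ℝ) ^ (-k+1))),
    (‖convM (Pproj β (k + j) f) μ t x‖₊ : ℝ≥0∞)

/-- P_j(μ_t ∗ μ̄_s)(x) = ∫ e^{2πi x·ξ} β(2^{−j}|ξ|) μ̂(tξ) conj(μ̂(sξ)) dξ. -/
def Kdisp (μ : Measure (EuclideanSpace ℝ (Fin d))) (β : ℝ → ℝ) (j : ℕ) (t s : ℝ)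
    (x : EuclideanSpace ℝ (Fin d)) : ℂ :=
  ∫ ξ, Complex.exp (2 * (π : ℂ) * Complex.I * ((⟪x, ξ⟫ : ℝ) : ℂ)) *
    ((β ((2:ℝ) ^ (-(j:ℤ)) * ‖ξ‖) : ℝ) : ℂ) * (mFT μ (t • ξ) * (starRingEnd ℂ) (mFT μ (s • ξ)))

/-- Convolution of a nonnegative function with a dilated measure, valued in [0,∞]. -/
def convNN (g : EuclideanSpace ℝ (Fin d) → ℝ) (σ : Measure (EuclideanSpace ℝ (Fin d)))
    (t : ℝ) (x : EuclideanSpace ℝ (Fin d)) : ℝ≥0∞ :=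
  ∫⁻ y, ENNReal.ofReal (g (x - t • y)) ∂σ


/-- Shorthand for Euclidean space. -/
abbrev EE (d : ℕ) := EuclideanSpace ℝ (Fin d)

/-- Hardy–Littlewood maximal function. -/
def HL (g : EE d → ℝ≥0∞) (x : EE d) : ℝ≥0∞ :=
  ⨆ r : {r : ℝ // 0 < r}, (ENNReal.ofReal (r.1 ^ d))⁻¹ * ∫⁻ y in ball x r.1, g y

lemma le_HL (g : EE d → ℝ≥0∞) (x : EE d) {r : ℝ} (hr : 0 < r) :
    ∫⁻ y in ball x r, g y ≤ ENNReal.ofReal (r ^ d) * HL g x := by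
  have h : (ENNReal.ofReal (r ^ d))⁻¹ * ∫⁻ y in ball x r, g y ≤ HL g x :=
    le_iSup (fun r : {r : ℝ // 0 < r} =>
      (ENNReal.ofReal (r.1 ^ d))⁻¹ * ∫⁻ y in ball x r.1, g y) ⟨r, hr⟩
  have h0 : ENNReal.ofReal (r ^ d) ≠ 0 := by
    simp only [ne_eq, ENNReal.ofReal_eq_zero, not_le]; positivity
  calc ∫⁻ y in ball x r, g y
      = ENNReal.ofReal (r ^ d) * ((ENNReal.ofReal (r ^ d))⁻¹ * ∫⁻ y in ball x r, g y) := by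
        rw [← mul_assoc, ENNReal.mul_inv_cancel h0 ENNReal.ofReal_ne_top, one_mul]
    _ ≤ _ := by gcongr

lemma HL_weak (hd : 1 ≤ d) : ∃ K : ℝ, 0 < K ∧ ∀ (g : EE d → ℝ≥0∞) (l : ℝ), 0 < l →
    volume {x | ENNReal.ofReal l < HL g x} ≤
      ENNReal.ofReal (K / l) * ∫⁻ x, g x := by
  have : Nonempty (Fin d) := ⟨⟨0, hd⟩⟩
  set V : ℝ := (volume (ball (0 : EE d) 1)).toReal with hV
  have hVtop : volume (ball (0 : EE d) 1) ≠ ⊤ := measure_ball_lt_top.ne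
  have hV0 : 0 < V := ENNReal.toReal_pos (measure_ball_pos _ _ one_pos).ne' hVtop
  refine ⟨5 ^ d * V, by positivity, fun g l hl => ?_⟩
  by_cases hI : ∫⁻ x, g x = ⊤
  · rw [hI, ENNReal.mul_top]
    · exact le_top
    · simp only [ne_eq, ENNReal.ofReal_eq_zero, not_le]; positivity
  set I := (∫⁻ x, g x).toReal with hIdef
  have hIeq : ∫⁻ x, g x = ENNReal.ofReal I := (ENNReal.ofReal_toReal hI).symm
  have hex : ∀ x : {x | ENNReal.ofReal l < HL g x}, ∃ r : ℝ, 0 < r ∧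
      ENNReal.ofReal (l * r ^ d) ≤ ∫⁻ y in ball x.1 r, g y := by
    rintro ⟨x, hx⟩
    simp only [mem_ofPred_eq, HL, lt_iSup_iff] at hx
    obtain ⟨⟨r, hr⟩, h⟩ := hx
    refine ⟨r, hr, ?_⟩
    have h0 : ENNReal.ofReal (r ^ d) ≠ 0 := by
      simp only [ne_eq, ENNReal.ofReal_eq_zero, not_le]; positivity
    rw [ENNReal.ofReal_mul hl.le]
    calc ENNReal.ofReal l * ENNReal.ofReal (r ^ d) ≤
        ((ENNReal.ofReal (r ^ d))⁻¹ * ∫⁻ y in ball x r, g y) * ENNReal.ofReal (r ^ d) := by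
          gcongr
      _ = ∫⁻ y in ball x r, g y := by
        rw [mul_comm, ← mul_assoc, ENNReal.mul_inv_cancel h0 ENNReal.ofReal_ne_top, one_mul]
  choose r hr hlr using hex
  have hrR : ∀ a ∈ (univ : Set {x | ENNReal.ofReal l < HL g x}), r a ≤ 1 + I / l := by
    intro a _
    have h1 : ENNReal.ofReal (l * r a ^ d) ≤ ENNReal.ofReal I := by
      rw [← hIeq]; exact (hlr a).trans (setLIntegral_le_lintegral _ _)
    have hI0 : 0 ≤ I := ENNReal.toReal_nonneg
    have h2 : l * r a ^ d ≤ I := (ENNReal.ofReal_le_ofReal_iff hI0).1 h1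
    rcases le_total (r a) 1 with h | h
    · have : 0 ≤ I / l := by positivity
      linarith
    · have h3 : r a ≤ r a ^ d := le_self_pow₀ h (by omega)
      have : r a ≤ I / l := by rw [le_div_iff₀ hl]; nlinarith
      linarith
  obtain ⟨u, -, hdis, hcov⟩ := Vitali.exists_disjoint_subfamily_covering_enlargement_ball
    (univ : Set {x | ENNReal.ofReal l < HL g x}) (fun a => a.1) r _ hrR 5 (by norm_num)
  have hcount : u.Countable := hdis.countable_of_isOpen (fun _ _ => isOpen_ball)
    (fun a _ => ⟨a.1, mem_ball_self (hr a)⟩)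
  have hsub : {x | ENNReal.ofReal l < HL g x} ⊆ ⋃ b ∈ u, ball b.1 (5 * r b) := by
    intro x hx
    obtain ⟨b, hb, h⟩ := hcov ⟨x, hx⟩ (mem_univ _)
    exact mem_biUnion hb (h (mem_ball_self (hr _)))
  calc volume {x | ENNReal.ofReal l < HL g x}
      ≤ volume (⋃ b ∈ u, ball b.1 (5 * r b)) := measure_mono hsub
    _ ≤ ∑' b : u, volume (ball b.1.1 (5 * r b)) := measure_biUnion_le _ hcount _
    _ ≤ ∑' b : u, ENNReal.ofReal (5 ^ d * V / l) * ∫⁻ y in ball b.1.1 (r b), g y := by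
        refine ENNReal.tsum_le_tsum fun b => ?_
        have hb := hr b.1
        calc volume (ball b.1.1 (5 * r b))
            = ENNReal.ofReal (5 ^ d * V / l) * ENNReal.ofReal (l * r b ^ d) := by
              rw [Measure.addHaar_ball _ _ (by positivity), ← ENNReal.ofReal_toReal hVtop, ← hV,
                ← ENNReal.ofReal_mul (by positivity), ← ENNReal.ofReal_mul (by positivity)]
              congr 1
              rw [finrank_euclideanSpace_fin]
              rw [mul_pow]; field_simp
          _ ≤ _ := by gcongr; exact hlr b
    _ = ENNReal.ofReal (5 ^ d * V / l) * ∑' b : u, ∫⁻ y in ball b.1.1 (r b), g y :=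
        ENNReal.tsum_mul_left
    _ = ENNReal.ofReal (5 ^ d * V / l) * ∫⁻ y in ⋃ b ∈ u, ball b.1 (r b), g y := by
        rw [lintegral_biUnion hcount (fun _ _ => measurableSet_ball) hdis]
    _ ≤ _ := by gcongr; exact Measure.restrict_le_self

open Filter in
lemma plancherel_fourier (h : EE d → ℂ) (h1 : Integrable h) (h2 : MemLp h 2) :
    ∫⁻ x, ‖𝓕 h x‖ₑ ^ 2 = ∫⁻ x, ‖h x‖ₑ ^ 2 := by
  set u : Lp ℂ 2 (volume : Measure (EE d)) := 𝓕 (h2.toLp h) with hu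
  have hcont : Continuous (𝓕 h) :=
    VectorFourier.fourierIntegral_continuous Real.continuous_fourierChar
      (by exact continuous_inner) h1
  have hae : ∀ᵐ x, 𝓕 h x = u x := by
    apply ae_eq_of_integral_contDiff_smul_eq
    · exact hcont.locallyIntegrable
    · exact (Lp.memLp u).locallyIntegrable (by norm_num)
    · intro g g_smooth g_cpt
      have hg₁ : HasCompactSupport (Complex.ofRealCLM ∘ g) := g_cpt.comp_left rfl
      have hg₂ : ContDiff ℝ (⊤ : ℕ∞) (Complex.ofRealCLM ∘ g) := by fun_prop
      set G : SchwartzMap (EE d) ℂ := hg₁.toSchwartzMap hg₂ with hG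
      have e1 : ∫ x, g x • 𝓕 h x = ∫ x, 𝓕 (G : EE d → ℂ) x • h x := by
        have := VectorFourier.integral_fourierIntegral_smul_eq_flip (μ := volume) (ν := volume)
          (L := innerₗ (EE d)) (f := (G : EE d → ℂ)) (g := h) Real.continuous_fourierChar
          (by exact continuous_inner) G.integrable h1
        rw [flip_innerₗ] at this
        refine Eq.trans ?_ this.symm
        refine integral_congr_ae (Eventually.of_forall fun x => ?_)
        simp [hG]; left; rfl
      have e2 : ∫ x, g x • u x = (Lp.toTemperedDistribution u) G := by
        rw [Lp.toTemperedDistribution_apply]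
        simp [hG]
      rw [e1, e2, hu, ← Lp.fourier_toTemperedDistribution_eq, TemperedDistribution.fourier_apply,
        Lp.toTemperedDistribution_apply]
      apply integral_congr_ae
      filter_upwards [h2.coeFn_toLp] with x hx
      rw [hx]; rfl
  have hnorm : ‖u‖ = ‖h2.toLp h‖ := Lp.norm_fourier_eq _
  have he : eLpNorm (𝓕 h) 2 volume = eLpNorm h 2 volume := by
    rw [eLpNorm_congr_ae hae, ← eLpNorm_congr_ae h2.coeFn_toLp]
    rw [Lp.norm_def, Lp.norm_def] at hnorm
    exact (ENNReal.toReal_eq_toReal_iff' (Lp.eLpNorm_ne_top _) (Lp.eLpNorm_ne_top _)).1 hnorm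
  have key : ∀ k : EE d → ℂ, ∫⁻ x, ‖k x‖ₑ ^ 2 = (eLpNorm k 2 volume) ^ 2 := by
    intro k
    rw [eLpNorm_eq_lintegral_rpow_enorm_toReal (by norm_num) (by norm_num)]
    simp only [ENNReal.toReal_ofNat, ENNReal.rpow_ofNat]
    rw [← ENNReal.rpow_natCast, ← ENNReal.rpow_mul]
    norm_num
  rw [key, key, he]

lemma plancherel_fourierInv (h : EE d → ℂ) (h1 : Integrable h) (h2 : MemLp h 2) :
    ∫⁻ x, ‖𝓕⁻ h x‖ₑ ^ 2 = ∫⁻ x, ‖h x‖ₑ ^ 2 := by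
  rw [← plancherel_fourier h h1 h2]
  simp_rw [Real.fourierInv_eq_fourier_neg]
  exact lintegral_neg_eq_self (fun x => ‖𝓕 h x‖ₑ ^ 2)

/-- The exponential e^{2πiu}. -/
def ec (u : ℝ) : ℂ := Complex.exp (2 * (π : ℂ) * Complex.I * (u : ℂ))

lemma norm_ec (u : ℝ) : ‖ec u‖ = 1 := by
  have : 2 * (π : ℂ) * Complex.I * (u : ℂ) = ((2 * π * u : ℝ) : ℂ) * Complex.I := by
    push_cast; ring
  rw [ec, this, Complex.norm_exp_ofReal_mul_I]

lemma enorm_ec (u : ℝ) : ‖ec u‖ₑ = 1 := by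
  rw [← ofReal_norm, norm_ec, ENNReal.ofReal_one]

@[fun_prop]
lemma continuous_ec : Continuous ec := by unfold ec; fun_prop

lemma ec_add (u v : ℝ) : ec (u + v) = ec u * ec v := by
  simp only [ec]; rw [← Complex.exp_add]; congr 1; push_cast; ring

lemma mFT_eq (μ : Measure (EE d)) (ξ : EE d) : mFT μ ξ = ∫ x, ec (-⟪x, ξ⟫) ∂μ := by
  unfold mFT ec; congr 1; ext x; congr 1; push_cast; ring

/-- Fourier multiplier operator with dilated multiplier `m (t ξ)`. -/
def mult (m : EE d → ℂ) (t : ℝ) (f : SchwartzMap (EE d) ℂ) (x : EE d) : ℂ :=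
  ∫ ξ, ec ⟪x, ξ⟫ * (m (t • ξ) * 𝓕 f ξ)

lemma mult_eq_fourierInv (m : EE d → ℂ) (t : ℝ) (f : SchwartzMap (EE d) ℂ) (x : EE d) :
    mult m t f x = 𝓕⁻ (fun ξ => m (t • ξ) * 𝓕 f ξ) x := by
  rw [Real.fourierInv_eq', mult]
  congr 1; ext ξ
  rw [smul_eq_mul, ec, real_inner_comm]
  congr 2; push_cast; ring

lemma mult_integrable {m : EE d → ℂ} (hm : Continuous m) {α : ℝ} (hα : ∀ ξ, ‖m ξ‖ ≤ α) (t : ℝ)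
    (f : SchwartzMap (EE d) ℂ) : Integrable (fun ξ => m (t • ξ) * 𝓕 f ξ) :=
  (𝓕 f).integrable.bdd_mul (c := α)
    ((hm.comp (continuous_const_smul t)).aestronglyMeasurable)
    (Filter.Eventually.of_forall fun ξ => hα _)

lemma mult_integrable' {m : EE d → ℂ} (hm : Continuous m) {α : ℝ} (hα : ∀ ξ, ‖m ξ‖ ≤ α) (t : ℝ)
    (f : SchwartzMap (EE d) ℂ) (x : EE d) :
    Integrable (fun ξ => ec ⟪x, ξ⟫ * (m (t • ξ) * 𝓕 f ξ)) :=
  (mult_integrable hm hα t f).bdd_mul (c := 1)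
    (Continuous.aestronglyMeasurable (by fun_prop))
    (Filter.Eventually.of_forall fun ξ => (norm_ec _).le)

lemma mult_memLp {m : EE d → ℂ} (hm : Continuous m) {α : ℝ} (hα : ∀ ξ, ‖m ξ‖ ≤ α) (t : ℝ)
    (f : SchwartzMap (EE d) ℂ) : MemLp (fun ξ => m (t • ξ) * 𝓕 f ξ) 2 :=
  ((𝓕 f).memLp 2).of_le_mul (c := α)
    (((hm.comp (continuous_const_smul t)).mul (𝓕 f).continuous).aestronglyMeasurable)
    (Filter.Eventually.of_forall fun ξ => by
      rw [norm_mul]; gcongr; exact hα _)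

lemma mult_plancherel {m : EE d → ℂ} (hm : Continuous m) {α : ℝ} (hα : ∀ ξ, ‖m ξ‖ ≤ α) (t : ℝ)
    (f : SchwartzMap (EE d) ℂ) :
    ∫⁻ x, ‖mult m t f x‖ₑ ^ 2 = ∫⁻ ξ, ‖m (t • ξ)‖ₑ ^ 2 * ‖𝓕 f ξ‖ₑ ^ 2 := by
  simp_rw [mult_eq_fourierInv]
  rw [plancherel_fourierInv _ (mult_integrable hm hα t f) (mult_memLp hm hα t f)]
  simp_rw [enorm_mul, mul_pow]

lemma mult_continuous {m : EE d → ℂ} (hm : Continuous m) {α : ℝ} (hα : ∀ ξ, ‖m ξ‖ ≤ α)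
    (f : SchwartzMap (EE d) ℂ) : Continuous (fun p : ℝ × EE d => mult m p.1 f p.2) := by
  unfold mult
  have hf := (𝓕 f).continuous
  refine continuous_of_dominated (bound := fun ξ => α * ‖𝓕 f ξ‖) ?_ ?_ ?_ ?_
  · intro p; exact Continuous.aestronglyMeasurable (by fun_prop)
  · intro p; refine Filter.Eventually.of_forall fun ξ => ?_
    rw [norm_mul, norm_ec, one_mul, norm_mul]; gcongr; exact hα _
  · exact (𝓕 f).integrable.norm.const_mul _
  · refine Filter.Eventually.of_forall fun ξ => ?_
    fun_prop

open Filter Topology in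
lemma mult_tendsto {m : EE d → ℂ} (hm : Continuous m) {α : ℝ} (hα : ∀ ξ, ‖m ξ‖ ≤ α)
    (ρ : ℝ) (hd : 1 ≤ d) (hsupp : ∀ ξ, ρ < ‖ξ‖ → m ξ = 0)
    (f : SchwartzMap (EE d) ℂ) (x : EE d) :
    Tendsto (fun t => mult m t f x) atTop (𝓝 0) := by
  have : Nonempty (Fin d) := ⟨⟨0, hd⟩⟩
  have hf := (𝓕 f).continuous
  have h0 : (0 : ℂ) = ∫ ξ : EE d, (0 : ℂ) := by simp
  rw [h0]
  unfold mult
  refine tendsto_integral_filter_of_dominated_convergence (fun ξ => α * ‖𝓕 f ξ‖) ?_ ?_ ?_ ?_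
  · exact Eventually.of_forall fun p => Continuous.aestronglyMeasurable (by fun_prop)
  · refine Eventually.of_forall fun t => Eventually.of_forall fun ξ => ?_
    rw [norm_mul, norm_ec, one_mul, norm_mul]; gcongr; exact hα _
  · exact (𝓕 f).integrable.norm.const_mul _
  · have : ∀ᵐ ξ : EE d, ξ ≠ 0 := by
      rw [ae_iff]; simp
    filter_upwards [this] with ξ hξ
    apply tendsto_const_nhds.congr'
    have hn : 0 < ‖ξ‖ := norm_pos_iff.2 hξ
    filter_upwards [eventually_gt_atTop (max 0 (ρ / ‖ξ‖))] with t ht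
    have h1 : 0 < t := (le_max_left _ _).trans_lt ht
    have h2 : ρ / ‖ξ‖ < t := (le_max_right _ _).trans_lt ht
    rw [hsupp, zero_mul, mul_zero]
    rw [norm_smul, Real.norm_of_nonneg h1.le]
    rwa [div_lt_iff₀ hn] at h2

lemma mult_hasDerivAt {m D : EE d → ℂ} (hm : Continuous m) (hD : Continuous D)
    {α β : ℝ} (hα : ∀ ξ, ‖m ξ‖ ≤ α) (hβ : ∀ ξ, ‖D ξ‖ ≤ β)
    (hder : ∀ (ξ : EE d) (t : ℝ), 0 < t →
      HasDerivAt (fun s : ℝ => m (s • ξ)) (D (t • ξ) / t) t)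
    (f : SchwartzMap (EE d) ℂ) (x : EE d) {t : ℝ} (ht : 0 < t) :
    HasDerivAt (fun t => mult m t f x) (mult D t f x / t) t := by
  have hf := (𝓕 f).continuous
  have hβ0 : 0 ≤ β := (norm_nonneg _).trans (hβ 0)
  have := hasDerivAt_integral_of_dominated_loc_of_deriv_le (μ := (volume : Measure (EE d)))
    (F := fun t ξ => ec ⟪x, ξ⟫ * (m (t • ξ) * 𝓕 f ξ))
    (F' := fun t ξ => ec ⟪x, ξ⟫ * ((D (t • ξ) / t) * 𝓕 f ξ)) (x₀ := t) (s := Ioi (t / 2))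
    (bound := fun ξ => (β / (t / 2)) * ‖𝓕 f ξ‖) (Ioi_mem_nhds (by linarith))
    (Filter.Eventually.of_forall fun s => Continuous.aestronglyMeasurable (by fun_prop))
    (mult_integrable' hm hα t f x)
    (Continuous.aestronglyMeasurable (by fun_prop))
    (Filter.Eventually.of_forall fun ξ s hs => by
      have hs : t / 2 < s := hs
      have hs0 : 0 < s := by linarith
      rw [norm_mul, norm_ec, one_mul, norm_mul, norm_div, Complex.norm_real,
        Real.norm_of_nonneg hs0.le]
      gcongr
      exact hβ _)
    ((𝓕 f).integrable.norm.const_mul _)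
    (Filter.Eventually.of_forall fun ξ s hs => by
      have hs : t / 2 < s := hs
      exact ((hder ξ s (by linarith)).mul_const _).const_mul _)
  have e : mult D t f x / t = ∫ ξ, ec ⟪x, ξ⟫ * ((D (t • ξ) / t) * 𝓕 f ξ) := by
    unfold mult
    rw [← integral_div]
    congr 1; ext ξ; ring
  rw [e]
  exact this.2

open Filter Topology in
/-- Sobolev-type bound in the dilation parameter, for functions of one variable. -/
lemma sobolev_sq_le {F G : ℝ → ℂ} (hcF : Continuous F) (hcG : Continuous G)
    (hder : ∀ t : ℝ, 0 < t → HasDerivAt F (G t / t) t)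
    (hF0 : Tendsto F atTop (𝓝 0)) {l : ℝ} (hl : 0 < l) {t : ℝ} (ht : 0 < t) :
    ‖F t‖ₑ ^ 2 ≤ ∫⁻ s in Ioi (0 : ℝ), (ENNReal.ofReal (l / s) * ‖F s‖ₑ ^ 2 +
      ENNReal.ofReal (1 / (l * s)) * ‖G s‖ₑ ^ 2) := by
  set R := ∫⁻ s in Ioi (0 : ℝ), (ENNReal.ofReal (l / s) * ‖F s‖ₑ ^ 2 +
      ENNReal.ofReal (1 / (l * s)) * ‖G s‖ₑ ^ 2) with hR
  have key : ∀ T, t ≤ T → ‖F t‖ₑ ^ 2 ≤ ‖F T‖ₑ ^ 2 + R := by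
    intro T hT
    have hpos : ∀ s ∈ uIcc t T, 0 < s := by
      intro s hs; rw [uIcc_of_le hT] at hs; exact ht.trans_le hs.1
    have hdv : ∀ s ∈ uIcc t T, HasDerivAt (fun s => ‖F s‖ ^ 2)
        (2 * ⟪F s, G s / s⟫) s := fun s hs =>
      (hder s (hpos s hs)).norm_sq
    have hco : ContinuousOn (fun s : ℝ => 2 * ⟪F s, G s / (s : ℂ)⟫)
        (uIcc t T) := by
      refine ContinuousOn.mul continuousOn_const (ContinuousOn.inner hcF.continuousOn ?_)
      refine ContinuousOn.div hcG.continuousOn (by fun_prop) ?_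
      intro s hs; exact_mod_cast (hpos s hs).ne'
    have hftc := intervalIntegral.integral_eq_sub_of_hasDerivAt hdv hco.intervalIntegrable
    have hle : ‖∫ s in t..T, 2 * ⟪F s, G s / (s : ℂ)⟫‖ₑ ≤ R := by
      rw [intervalIntegral.integral_of_le hT]
      refine (enorm_integral_le_lintegral_enorm _).trans ?_
      refine (lintegral_mono_set (t := Ioi 0) ?_).trans ?_
      · intro s hs; exact ht.trans hs.1
      rw [hR]
      refine setLIntegral_mono' measurableSet_Ioi fun s hs => ?_
      have hs : 0 < s := hs
      have e : ENNReal.ofReal (l / s) * ‖F s‖ₑ ^ 2 +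
          ENNReal.ofReal (1 / (l * s)) * ‖G s‖ₑ ^ 2 =
          ENNReal.ofReal (l / s * ‖F s‖ ^ 2 + 1 / (l * s) * ‖G s‖ ^ 2) := by
        rw [ENNReal.ofReal_add (by positivity) (by positivity), ENNReal.ofReal_mul (by positivity),
          ENNReal.ofReal_mul (by positivity), ← ofReal_norm, ← ofReal_norm,
          ENNReal.ofReal_pow (norm_nonneg _), ENNReal.ofReal_pow (norm_nonneg _)]
      rw [e, ← ofReal_norm]
      apply ENNReal.ofReal_le_ofReal
      rw [norm_mul, Real.norm_of_nonneg (by norm_num : (0:ℝ) ≤ 2)]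
      have h1 : ‖⟪F s, G s / (s : ℂ)⟫‖ ≤
          ‖F s‖ * (‖G s‖ / s) := by
        refine (norm_inner_le_norm _ _).trans ?_
        rw [norm_div, Complex.norm_real, Real.norm_of_nonneg hs.le]
      have h2 : l / s * ‖F s‖ ^ 2 + 1 / (l * s) * ‖G s‖ ^ 2
          - 2 * (‖F s‖ * (‖G s‖ / s)) =
          (l * ‖F s‖ - ‖G s‖) ^ 2 / (l * s) := by
        field_simp; ring
      have h3 : 0 ≤ (l * ‖F s‖ - ‖G s‖) ^ 2 / (l * s) := by positivity
      linarith
    rw [hftc] at hle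
    have h4 : ‖F t‖ ^ 2 ≤ ‖F T‖ ^ 2 +
        ‖‖F T‖ ^ 2 - ‖F t‖ ^ 2‖ := by
      rw [Real.norm_eq_abs]
      have := neg_abs_le (‖F T‖ ^ 2 - ‖F t‖ ^ 2)
      linarith
    have h5 := ENNReal.ofReal_le_ofReal h4
    rw [ENNReal.ofReal_add (by positivity) (by positivity), ENNReal.ofReal_pow (norm_nonneg _),
      ENNReal.ofReal_pow (norm_nonneg _), ofReal_norm, ofReal_norm, ofReal_norm] at h5
    exact h5.trans (by gcongr)
  have hlim : Tendsto (fun T => ‖F T‖ₑ ^ 2 + R) atTop (𝓝 (0 + R)) := by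
    refine Tendsto.add ?_ tendsto_const_nhds
    have h1 := hF0.enorm
    have h2 := ((ENNReal.continuous_pow 2).tendsto _).comp h1
    simpa [Function.comp_def] using h2
  rw [zero_add] at hlim
  refine ge_of_tendsto hlim ?_
  filter_upwards [eventually_ge_atTop t] with T hT using key T hT

lemma mult_continuous_t {m : EE d → ℂ} (hm : Continuous m) {α : ℝ} (hα : ∀ ξ, ‖m ξ‖ ≤ α)
    (f : SchwartzMap (EE d) ℂ) (x : EE d) : Continuous (fun s => mult m s f x) :=
  Continuous.comp (g := fun p : ℝ × EE d => mult m p.1 f p.2) (f := fun s : ℝ => (s, x))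
    (mult_continuous hm hα f) (by fun_prop)

/-- Sobolev-type bound in the dilation parameter. -/
lemma mult_sq_le {m D : EE d → ℂ} (hm : Continuous m) (hD : Continuous D)
    {α β : ℝ} (hα : ∀ ξ, ‖m ξ‖ ≤ α) (hβ : ∀ ξ, ‖D ξ‖ ≤ β)
    (hder : ∀ (ξ : EE d) (t : ℝ), 0 < t →
      HasDerivAt (fun s : ℝ => m (s • ξ)) (D (t • ξ) / t) t)
    (ρ : ℝ) (hd : 1 ≤ d) (hsupp : ∀ ξ, ρ < ‖ξ‖ → m ξ = 0) {l : ℝ} (hl : 0 < l)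
    (f : SchwartzMap (EE d) ℂ) (x : EE d) {t : ℝ} (ht : 0 < t) :
    ‖mult m t f x‖ₑ ^ 2 ≤ ∫⁻ s in Ioi (0 : ℝ), (ENNReal.ofReal (l / s) * ‖mult m s f x‖ₑ ^ 2 +
      ENNReal.ofReal (1 / (l * s)) * ‖mult D s f x‖ₑ ^ 2) := by
  exact sobolev_sq_le (F := fun s => mult m s f x) (G := fun s => mult D s f x) (mult_continuous_t hm hα f x)
    (mult_continuous_t hD hβ f x) (fun s hs => mult_hasDerivAt hm hD hα hβ hder f x hs)
    (mult_tendsto hm hα ρ hd hsupp f x) hl ht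

lemma annulus_lintegral {ρ : ℝ} (hρ : 0 < ρ) (k : EE d → ℂ) {α : ℝ}
    (hα : ∀ ξ, ‖k ξ‖ ≤ α) (hlow : ∀ ξ, ‖ξ‖ < ρ → k ξ = 0)
    (hsupp : ∀ ξ, 4 * ρ < ‖ξ‖ → k ξ = 0) (ξ : EE d) {l : ℝ} (hl : 0 < l) :
    ∫⁻ s in Ioi (0 : ℝ), ENNReal.ofReal (l / s) * ‖k (s • ξ)‖ₑ ^ 2 ≤
      ENNReal.ofReal (3 * l * α ^ 2) := by
  have hα0 : 0 ≤ α := (norm_nonneg _).trans (hα 0)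
  rcases eq_or_ne ξ 0 with rfl | hξ
  · simp [hlow 0 (by simpa using hρ)]
  have hn : 0 < ‖ξ‖ := norm_pos_iff.2 hξ
  calc ∫⁻ s in Ioi (0 : ℝ), ENNReal.ofReal (l / s) * ‖k (s • ξ)‖ₑ ^ 2
      ≤ ∫⁻ s in Ioi (0 : ℝ), (Icc (ρ / ‖ξ‖) (4 * ρ / ‖ξ‖)).indicator
          (fun _ => ENNReal.ofReal (l * ‖ξ‖ / ρ * α ^ 2)) s := by
        refine setLIntegral_mono' measurableSet_Ioi fun s hs => ?_
        have hs : 0 < s := hs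
        have hsn : ‖s • ξ‖ = s * ‖ξ‖ := by rw [norm_smul, Real.norm_of_nonneg hs.le]
        by_cases h : s ∈ Icc (ρ / ‖ξ‖) (4 * ρ / ‖ξ‖)
        · rw [indicator_of_mem h, ← ofReal_norm, ← ENNReal.ofReal_pow (norm_nonneg _),
            ← ENNReal.ofReal_mul (by positivity)]
          apply ENNReal.ofReal_le_ofReal
          have hq : l / s ≤ l * ‖ξ‖ / ρ := by
            rw [div_le_div_iff₀ hs hρ]
            have := (div_le_iff₀ hn).1 h.1
            nlinarith
          exact mul_le_mul hq (pow_le_pow_left₀ (norm_nonneg _) (hα _) 2) (by positivity)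
            (by positivity)
        · have : k (s • ξ) = 0 := by
            rw [mem_Icc, not_and_or, not_le, not_le] at h
            rcases h with h | h
            · apply hlow; rw [hsn]; rwa [lt_div_iff₀ hn] at h
            · apply hsupp; rw [hsn]; rwa [div_lt_iff₀ hn] at h
          simp [this]
    _ ≤ ∫⁻ s, (Icc (ρ / ‖ξ‖) (4 * ρ / ‖ξ‖)).indicator
          (fun _ => ENNReal.ofReal (l * ‖ξ‖ / ρ * α ^ 2)) s := setLIntegral_le_lintegral _ _
    _ = ENNReal.ofReal (3 * l * α ^ 2) := by
        rw [lintegral_indicator_const measurableSet_Icc, Real.volume_Icc,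
          ← ENNReal.ofReal_mul (by positivity)]
        congr 1; field_simp; ring

lemma lintegral_fourier_sq (f : SchwartzMap (EE d) ℂ) :
    ∫⁻ ξ, ‖𝓕 f ξ‖ₑ ^ 2 = ∫⁻ x, ‖f x‖ₑ ^ 2 :=
  plancherel_fourier f f.integrable (f.memLp 2)

lemma mult_sq_int {k : EE d → ℂ} (hk : Continuous k) {ρ : ℝ} (hρ : 0 < ρ) {α : ℝ}
    (hα : ∀ ξ, ‖k ξ‖ ≤ α) (hlow : ∀ ξ, ‖ξ‖ < ρ → k ξ = 0)
    (hsupp : ∀ ξ, 4 * ρ < ‖ξ‖ → k ξ = 0) {l : ℝ} (hl : 0 < l) (f : SchwartzMap (EE d) ℂ) :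
    ∫⁻ x, ∫⁻ s in Ioi (0 : ℝ), ENNReal.ofReal (l / s) * ‖mult k s f x‖ₑ ^ 2 ≤
      ENNReal.ofReal (3 * l * α ^ 2) * ∫⁻ x, ‖f x‖ₑ ^ 2 := by
  have hc := mult_continuous hk hα f
  have hf := (𝓕 f).continuous
  have hms : Measurable (fun s : ℝ => ENNReal.ofReal (l / s)) := by fun_prop
  calc ∫⁻ x, ∫⁻ s in Ioi (0 : ℝ), ENNReal.ofReal (l / s) * ‖mult k s f x‖ₑ ^ 2
      = ∫⁻ s in Ioi (0 : ℝ), ∫⁻ x, ENNReal.ofReal (l / s) * ‖mult k s f x‖ₑ ^ 2 := by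
        refine lintegral_lintegral_swap (Measurable.aemeasurable ?_)
        have h1 : Measurable (fun p : EE d × ℝ => mult k p.2 f p.1) :=
          (hc.comp continuous_swap).measurable
        exact (hms.comp measurable_snd).mul (h1.enorm.pow_const 2)
    _ = ∫⁻ s in Ioi (0 : ℝ), ∫⁻ ξ, ENNReal.ofReal (l / s) * ‖k (s • ξ)‖ₑ ^ 2 * ‖𝓕 f ξ‖ₑ ^ 2 := by
        refine lintegral_congr fun s => ?_
        rw [lintegral_const_mul' _ _ ENNReal.ofReal_ne_top, mult_plancherel hk hα s f,
          ← lintegral_const_mul' _ _ ENNReal.ofReal_ne_top]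
        simp_rw [mul_assoc]
    _ = ∫⁻ ξ, ∫⁻ s in Ioi (0 : ℝ), ENNReal.ofReal (l / s) * ‖k (s • ξ)‖ₑ ^ 2 * ‖𝓕 f ξ‖ₑ ^ 2 := by
        refine lintegral_lintegral_swap (Measurable.aemeasurable ?_)
        have h1 : Measurable (fun p : ℝ × EE d => k (p.1 • p.2)) :=
          Continuous.measurable (by fun_prop)
        have h2 : Measurable (fun p : ℝ × EE d => 𝓕 f p.2) :=
          Continuous.measurable (by fun_prop)
        exact ((hms.comp measurable_fst).mul (h1.enorm.pow_const 2)).mul (h2.enorm.pow_const 2)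
    _ ≤ ∫⁻ ξ, ENNReal.ofReal (3 * l * α ^ 2) * ‖𝓕 f ξ‖ₑ ^ 2 := by
        refine lintegral_mono fun ξ => ?_
        rw [lintegral_mul_const' _ _ (by simp)]
        gcongr
        exact annulus_lintegral hρ k hα hlow hsupp ξ hl
    _ = _ := by
        rw [lintegral_const_mul' _ _ ENNReal.ofReal_ne_top, lintegral_fourier_sq]

/-- Maximal multiplier operator. -/
def multStar (m : EE d → ℂ) (f : SchwartzMap (EE d) ℂ) (x : EE d) : ℝ≥0∞ :=
  ⨆ t : {t : ℝ // 0 < t}, ‖mult m t f x‖ₑ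

lemma multStar_L2 {m D : EE d → ℂ} (hm : Continuous m) (hD : Continuous D)
    {α β : ℝ} (hα : ∀ ξ, ‖m ξ‖ ≤ α) (hβ : ∀ ξ, ‖D ξ‖ ≤ β)
    (hder : ∀ (ξ : EE d) (t : ℝ), 0 < t →
      HasDerivAt (fun s : ℝ => m (s • ξ)) (D (t • ξ) / t) t)
    (hd : 1 ≤ d) {ρ : ℝ} (hρ : 0 < ρ) (hlow : ∀ ξ, ‖ξ‖ < ρ → m ξ = 0)
    (hsupp : ∀ ξ, 4 * ρ < ‖ξ‖ → m ξ = 0) (hlow' : ∀ ξ, ‖ξ‖ < ρ → D ξ = 0)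
    (hsupp' : ∀ ξ, 4 * ρ < ‖ξ‖ → D ξ = 0) {l : ℝ} (hl : 0 < l)
    (f : SchwartzMap (EE d) ℂ) :
    ∫⁻ x, multStar m f x ^ 2 ≤
      ENNReal.ofReal (3 * (l * α ^ 2 + β ^ 2 / l)) * ∫⁻ x, ‖f x‖ₑ ^ 2 := by
  have hc := mult_continuous hm hα f
  have hms : Measurable (fun s : ℝ => ENNReal.ofReal (l / s)) := by fun_prop
  calc ∫⁻ x, multStar m f x ^ 2
      ≤ ∫⁻ x, ∫⁻ s in Ioi (0 : ℝ), (ENNReal.ofReal (l / s) * ‖mult m s f x‖ₑ ^ 2 +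
      ENNReal.ofReal (1 / (l * s)) * ‖mult D s f x‖ₑ ^ 2) := by
        refine lintegral_mono fun x => ?_
        rw [← ENNReal.rpow_natCast]
        rw [← ENNReal.le_rpow_inv_iff (by norm_num)]
        refine iSup_le fun t => ?_
        rw [ENNReal.le_rpow_inv_iff (by norm_num), ENNReal.rpow_natCast]
        exact mult_sq_le hm hD hα hβ hder (4 * ρ) hd hsupp hl f x t.2
    _ = ∫⁻ x, ((∫⁻ s in Ioi (0 : ℝ), ENNReal.ofReal (l / s) * ‖mult m s f x‖ₑ ^ 2) +
      ∫⁻ s in Ioi (0 : ℝ), ENNReal.ofReal (l⁻¹ / s) * ‖mult D s f x‖ₑ ^ 2) := by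
        refine lintegral_congr fun x => ?_
        rw [lintegral_add_left]
        · congr 1
          refine lintegral_congr fun s => ?_
          congr 2; field_simp
        · have h1 : Measurable (fun s : ℝ => mult m s f x) :=
            (hc.comp (by fun_prop : Continuous fun s : ℝ => (s, x))).measurable
          exact hms.mul (h1.enorm.pow_const 2)
    _ = (∫⁻ x, ∫⁻ s in Ioi (0 : ℝ), ENNReal.ofReal (l / s) * ‖mult m s f x‖ₑ ^ 2) +
      ∫⁻ x, ∫⁻ s in Ioi (0 : ℝ), ENNReal.ofReal (l⁻¹ / s) * ‖mult D s f x‖ₑ ^ 2 := by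
        refine lintegral_add_left (Measurable.lintegral_prod_right' (f := fun p : EE d × ℝ =>
          ENNReal.ofReal (l / p.2) * ‖mult m p.2 f p.1‖ₑ ^ 2) ?_) _
        have h1 : Measurable (fun p : EE d × ℝ => mult m p.2 f p.1) :=
          (hc.comp continuous_swap).measurable
        exact (hms.comp measurable_snd).mul (h1.enorm.pow_const 2)
    _ ≤ ENNReal.ofReal (3 * l * α ^ 2) * (∫⁻ x, ‖f x‖ₑ ^ 2) +
        ENNReal.ofReal (3 * l⁻¹ * β ^ 2) * ∫⁻ x, ‖f x‖ₑ ^ 2 := by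
        gcongr
        · exact mult_sq_int hm hρ hα hlow hsupp hl f
        · exact mult_sq_int hD hρ hβ hlow' hsupp' (inv_pos.2 hl) f
    _ = _ := by
        rw [← add_mul, ← ENNReal.ofReal_add (by positivity) (by positivity)]
        congr 2; field_simp

/-- Fourier transform of the weighted measure `h μ`. -/
def wFT (μ : Measure (EE d)) (h : EE d → ℂ) (ξ : EE d) : ℂ := ∫ y, h y * ec (-⟪y, ξ⟫) ∂μ

lemma schwartz_bdd (h : SchwartzMap (EE d) ℂ) : ∃ K : ℝ, ∀ y, ‖h y‖ ≤ K := by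
  obtain ⟨K, -, hK⟩ := h.decay 0 0
  exact ⟨K, fun y => by simpa using hK y⟩

lemma wFT_continuous (μ : Measure (EE d)) [IsFiniteMeasure μ] (h : SchwartzMap (EE d) ℂ) :
    Continuous (wFT μ h) := by
  obtain ⟨K, hK⟩ := schwartz_bdd h
  unfold wFT
  have hh := h.continuous
  refine continuous_of_dominated (bound := fun _ => K) ?_ ?_ (integrable_const _) ?_
  · intro ξ; exact Continuous.aestronglyMeasurable (by fun_prop)
  · intro ξ; refine Filter.Eventually.of_forall fun y => ?_
    rw [norm_mul, norm_ec, mul_one]; exact hK y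
  · refine Filter.Eventually.of_forall fun y => ?_
    fun_prop

lemma mFT_continuous (μ : Measure (EE d)) [IsFiniteMeasure μ] : Continuous (mFT μ) := by
  have : mFT μ = fun ξ => ∫ x, ec (-⟪x, ξ⟫) ∂μ := by ext ξ; exact mFT_eq μ ξ
  rw [this]
  refine continuous_of_dominated (bound := fun _ => 1) ?_ ?_ (integrable_const _) ?_
  · intro ξ; exact Continuous.aestronglyMeasurable (by fun_prop)
  · intro ξ; exact Filter.Eventually.of_forall fun y => (norm_ec _).le
  · refine Filter.Eventually.of_forall fun y => ?_
    fun_prop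

lemma norm_mFT_le (μ : Measure (EE d)) [IsFiniteMeasure μ] (ξ : EE d) :
    ‖mFT μ ξ‖ ≤ μ.real univ := by
  rw [mFT_eq]
  refine (norm_integral_le_of_norm_le_const (C := 1)
    (Filter.Eventually.of_forall fun y => (norm_ec _).le)).trans ?_
  simp

lemma mFT_decay (μ : Measure (EE d)) [IsFiniteMeasure μ] {a C : ℝ} (ha : 0 < a)
    (hdecay : ∀ ξ : EE d, ξ ≠ 0 → ‖mFT μ ξ‖ ≤ C * ‖ξ‖ ^ (-a)) :
    ∃ C1 : ℝ, 0 < C1 ∧ ∀ ξ, ‖mFT μ ξ‖ ≤ C1 * (1 + ‖ξ‖) ^ (-a) := by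
  refine ⟨2 ^ a * (μ.real univ + |C| + 1), by positivity, fun ξ => ?_⟩
  rcases le_total ‖ξ‖ 1 with h | h
  · have h1 : (2 : ℝ) ^ (-a) ≤ (1 + ‖ξ‖) ^ (-a) :=
      Real.rpow_le_rpow_of_nonpos (by positivity) (by linarith) (by linarith)
    have h2 : (2 : ℝ) ^ a * 2 ^ (-a) = 1 := by rw [← Real.rpow_add (by norm_num)]; simp
    calc ‖mFT μ ξ‖ ≤ μ.real univ := norm_mFT_le μ ξ
      _ ≤ μ.real univ + |C| + 1 := by linarith [abs_nonneg C]
      _ = (2 : ℝ) ^ a * (μ.real univ + |C| + 1) * 2 ^ (-a) := by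
        rw [mul_comm ((2 : ℝ) ^ a), mul_assoc, h2, mul_one]
      _ ≤ _ := by gcongr
  · have hξ : ξ ≠ 0 := by rintro rfl; simp at h; linarith
    have hpos : 0 < ‖ξ‖ := norm_pos_iff.2 hξ
    have h3 : ‖ξ‖ ^ (-a) ≤ 2 ^ a * (1 + ‖ξ‖) ^ (-a) := by
      have : ((1 + ‖ξ‖) / 2) ^ (-a) = 2 ^ a * (1 + ‖ξ‖) ^ (-a) := by
        rw [Real.div_rpow (by positivity) (by norm_num), Real.rpow_neg (by norm_num : (0:ℝ) ≤ 2)]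
        field_simp
      rw [← this]
      exact Real.rpow_le_rpow_of_nonpos (by positivity) (by linarith) (by linarith)
    calc ‖mFT μ ξ‖ ≤ C * ‖ξ‖ ^ (-a) := hdecay ξ hξ
      _ ≤ (μ.real univ + |C| + 1) * ‖ξ‖ ^ (-a) := by
        gcongr
        have : 0 ≤ μ.real univ := measureReal_nonneg
        linarith [le_abs_self C]
      _ ≤ (μ.real univ + |C| + 1) * (2 ^ a * (1 + ‖ξ‖) ^ (-a)) := by gcongr
      _ = _ := by ring

lemma schwartz_inversion (h : SchwartzMap (EE d) ℂ) (y : EE d) :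
    h y = ∫ ζ, ec ⟪y, ζ⟫ * 𝓕 h ζ := by
  have h1 : h y = 𝓕⁻ (𝓕 h) y := by rw [FourierTransform.fourierInv_fourier_eq]
  rw [h1, SchwartzMap.fourierInv_coe, Real.fourierInv_eq']
  congr 1; ext ξ
  rw [smul_eq_mul, ec, real_inner_comm]
  congr 2; push_cast; ring

lemma wFT_eq_conv (μ : Measure (EE d)) [IsFiniteMeasure μ] (h : SchwartzMap (EE d) ℂ) (ξ : EE d) :
    wFT μ h ξ = ∫ ζ, 𝓕 h ζ * mFT μ (ξ - ζ) := by
  have hf := (𝓕 h).continuous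
  calc wFT μ h ξ = ∫ y, ∫ ζ, 𝓕 h ζ * ec (-⟪y, ξ - ζ⟫) ∂volume ∂μ := by
        unfold wFT
        congr 1; ext y
        rw [schwartz_inversion h y, ← integral_mul_const]
        congr 1; ext ζ
        rw [inner_sub_right, neg_sub, sub_eq_add_neg, ec_add]; ring
    _ = ∫ ζ, ∫ y, 𝓕 h ζ * ec (-⟪y, ξ - ζ⟫) ∂μ := by
        refine integral_integral_swap ?_
        have h1 : Integrable (fun p : EE d × EE d => (1 : ℂ) * 𝓕 h p.2) (μ.prod volume) :=
          (integrable_const (1 : ℂ)).mul_prod (𝓕 h).integrable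
        simp only [one_mul] at h1
        refine h1.mul_bdd (c := 1) (Continuous.aestronglyMeasurable (by fun_prop))
          (Filter.Eventually.of_forall fun p => (norm_ec _).le)
    _ = _ := by
        congr 1; ext ζ
        rw [integral_const_mul, mFT_eq]

lemma peetre {a : ℝ} (ha : 0 < a) (ξ ζ : EE d) :
    (1 + ‖ξ - ζ‖) ^ (-a) ≤ (1 + ‖ξ‖) ^ (-a) * (1 + ‖ζ‖) ^ a := by
  have h1 : 1 + ‖ξ‖ ≤ (1 + ‖ξ - ζ‖) * (1 + ‖ζ‖) := by
    have : ‖ξ‖ ≤ ‖ξ - ζ‖ + ‖ζ‖ := by simpa using norm_add_le (ξ - ζ) ζ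
    nlinarith [norm_nonneg (ξ - ζ), norm_nonneg ζ, mul_nonneg (norm_nonneg (ξ - ζ)) (norm_nonneg ζ)]
  have h2 : (1 + ‖ξ‖) ^ a ≤ (1 + ‖ξ - ζ‖) ^ a * (1 + ‖ζ‖) ^ a := by
    rw [← Real.mul_rpow (by positivity) (by positivity)]
    exact Real.rpow_le_rpow (by positivity) h1 ha.le
  rw [Real.rpow_neg (by positivity), Real.rpow_neg (by positivity), inv_mul_eq_div,
    le_div_iff₀ (by positivity), inv_mul_le_iff₀ (by positivity)]
  exact h2

lemma schwartz_weight_integrable (h : SchwartzMap (EE d) ℂ) {a : ℝ} (ha : 0 < a) :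
    Integrable (fun ζ => ‖h ζ‖ * (1 + ‖ζ‖) ^ a) := by
  obtain ⟨N, hN⟩ := exists_nat_ge a
  have h1 : Integrable (fun ζ => 2 ^ (N - 1) * (‖ζ‖ ^ 0 * ‖h ζ‖ + ‖ζ‖ ^ N * ‖h ζ‖)) :=
    ((h.integrable_pow_mul volume 0).add (h.integrable_pow_mul volume N)).const_mul _
  have hc := h.continuous
  refine h1.mono' (Continuous.aestronglyMeasurable ?_) (Filter.Eventually.of_forall fun ζ => ?_)
  · refine hc.norm.mul (Continuous.rpow_const (by fun_prop) fun x => Or.inl ?_)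
    positivity
  · rw [Real.norm_of_nonneg (by positivity)]
    have h2 : (1 + ‖ζ‖) ^ a ≤ (1 + ‖ζ‖) ^ N := by
      rw [← Real.rpow_natCast]
      exact Real.rpow_le_rpow_of_exponent_le (by linarith [norm_nonneg ζ]) hN
    have h3 := add_pow_le (zero_le_one) (norm_nonneg ζ) N
    rw [one_pow] at h3
    calc ‖h ζ‖ * (1 + ‖ζ‖) ^ a ≤ ‖h ζ‖ * (2 ^ (N - 1) * (1 + ‖ζ‖ ^ N)) := by
          gcongr; exact h2.trans h3
      _ = _ := by ring

lemma wFT_decay (μ : Measure (EE d)) [IsFiniteMeasure μ] {a C1 : ℝ} (ha : 0 < a)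
    (hC1 : 0 < C1) (hdecay : ∀ ξ : EE d, ‖mFT μ ξ‖ ≤ C1 * (1 + ‖ξ‖) ^ (-a))
    (h : SchwartzMap (EE d) ℂ) :
    ∃ C2 : ℝ, 0 ≤ C2 ∧ ∀ ξ, ‖wFT μ h ξ‖ ≤ C2 * (1 + ‖ξ‖) ^ (-a) := by
  refine ⟨C1 * ∫ ζ, ‖𝓕 h ζ‖ * (1 + ‖ζ‖) ^ a,
    mul_nonneg hC1.le (integral_nonneg fun ζ => by positivity), fun ξ => ?_⟩
  rw [wFT_eq_conv]
  have e : C1 * (∫ ζ, ‖𝓕 h ζ‖ * (1 + ‖ζ‖) ^ a) * (1 + ‖ξ‖) ^ (-a) =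
      ∫ ζ, C1 * (1 + ‖ξ‖) ^ (-a) * (‖𝓕 h ζ‖ * (1 + ‖ζ‖) ^ a) := by
    rw [integral_const_mul]; ring
  rw [e]
  refine norm_integral_le_of_norm_le ((schwartz_weight_integrable (𝓕 h) ha).const_mul _)
    (Filter.Eventually.of_forall fun ζ => ?_)
  rw [norm_mul]
  calc ‖𝓕 h ζ‖ * ‖mFT μ (ξ - ζ)‖
      ≤ ‖𝓕 h ζ‖ * (C1 * ((1 + ‖ξ‖) ^ (-a) * (1 + ‖ζ‖) ^ a)) := by
        gcongr
        refine (hdecay _).trans ?_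
        gcongr
        exact peetre ha ξ ζ
    _ = _ := by ring

/-- Existence and decay of the radial derivative of `mFT μ`. -/
lemma mFT_radial (μ : Measure (EE d)) [IsFiniteMeasure μ] {a C1 R : ℝ} (ha : 0 < a)
    (hC1 : 0 < C1) (hdecay : ∀ ξ : EE d, ‖mFT μ ξ‖ ≤ C1 * (1 + ‖ξ‖) ^ (-a))
    (hR : 0 < R) (hsupp : ∀ᵐ y ∂μ, ‖y‖ ≤ R) :
    ∃ (ν : EE d → ℂ) (C2 : ℝ), 0 ≤ C2 ∧ Continuous ν ∧
      (∀ ξ, ‖ν ξ‖ ≤ C2 * ‖ξ‖ * (1 + ‖ξ‖) ^ (-a)) ∧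
      ∀ (ξ : EE d) (t : ℝ), 0 < t →
        HasDerivAt (fun s : ℝ => mFT μ (s • ξ)) (ν (t • ξ) / t) t := by
  let χ : ContDiffBump (0 : EE d) := ⟨R, R + 1, hR, by linarith⟩
  have hχ1 : ∀ y : EE d, ‖y‖ ≤ R → χ y = 1 := fun y hy =>
    χ.one_of_mem_closedBall (by simpa using hy)
  have hcs : ∀ k : Fin d, HasCompactSupport (fun y : EE d => ((χ y * y k : ℝ) : ℂ)) := fun k =>
    (χ.hasCompactSupport.mul_right (f' := fun y : EE d => y k)).comp_left (g := Complex.ofReal)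
      Complex.ofReal_zero
  have hcd : ∀ k : Fin d, ContDiff ℝ (⊤ : ℕ∞) (fun y : EE d => ((χ y * y k : ℝ) : ℂ)) := fun k => by
    refine Complex.ofRealCLM.contDiff.comp (χ.contDiff.mul ?_)
    exact (EuclideanSpace.proj k : EE d →L[ℝ] ℝ).contDiff
  let h : Fin d → SchwartzMap (EE d) ℂ := fun k => (hcs k).toSchwartzMap (hcd k)
  have hh : ∀ k y, h k y = ((χ y * y k : ℝ) : ℂ) := fun k y => rfl
  choose C2 hC20 hC2 using fun k => wFT_decay μ ha hC1 hdecay (h k)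
  refine ⟨fun ξ => -(2 * (π : ℂ) * Complex.I) * ∑ k, ((ξ k : ℝ) : ℂ) * wFT μ (h k) ξ,
    2 * π * ∑ k, C2 k, mul_nonneg (by positivity) (Finset.sum_nonneg fun k _ => hC20 k), ?_, ?_, ?_⟩
  · have := fun k => wFT_continuous μ (h k)
    fun_prop
  · intro ξ
    rw [norm_mul]
    have e1 : ‖-(2 * (π : ℂ) * Complex.I)‖ = 2 * π := by
      simp [abs_of_pos Real.pi_pos]
    rw [e1]
    have e2 : 2 * π * (∑ k, C2 k) * ‖ξ‖ * (1 + ‖ξ‖) ^ (-a) =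
        2 * π * ∑ k, (‖ξ‖ * (C2 k * (1 + ‖ξ‖) ^ (-a))) := by
      rw [← Finset.mul_sum, ← Finset.sum_mul]; ring
    rw [e2]
    gcongr
    refine (norm_sum_le _ _).trans (Finset.sum_le_sum fun k _ => ?_)
    rw [norm_mul, Complex.norm_real]
    gcongr
    · exact PiLp.norm_apply_le ξ k
    · exact hC2 k ξ
  · intro ξ t ht
    have hd1 : ∀ y : EE d, ∀ s : ℝ, HasDerivAt (fun s : ℝ => ec (-⟪y, s • ξ⟫))
        (-(2 * (π : ℂ) * Complex.I) * (⟪y, ξ⟫ : ℝ) * ec (-⟪y, s • ξ⟫)) s := by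
      intro y s
      unfold ec
      have h0 : HasDerivAt (fun s : ℝ => 2 * (π : ℂ) * Complex.I * ((-⟪y, s • ξ⟫ : ℝ) : ℂ))
          (-(2 * (π : ℂ) * Complex.I) * (⟪y, ξ⟫ : ℝ)) s := by
        have h1 : HasDerivAt (fun s : ℝ => (s : ℂ)) 1 s := Complex.ofRealCLM.hasDerivAt
        have e0 : (fun s : ℝ => 2 * (π : ℂ) * Complex.I * ((-⟪y, s • ξ⟫ : ℝ) : ℂ)) =
            fun s : ℝ => (-(2 * (π : ℂ) * Complex.I) * (⟪y, ξ⟫ : ℝ)) * (s : ℂ) := by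
          ext s; rw [inner_smul_right]; push_cast; ring
        rw [e0]
        have h2 := h1.const_mul (-(2 * (π : ℂ) * Complex.I) * (⟪y, ξ⟫ : ℝ))
        rw [mul_one] at h2
        exact h2
      have h3 := h0.cexp
      rw [mul_comm (Complex.exp _)] at h3
      exact h3
    have hder := hasDerivAt_integral_of_dominated_loc_of_deriv_le (μ := μ)
      (F := fun (s : ℝ) y => ec (-⟪y, s • ξ⟫))
      (F' := fun (s : ℝ) y => -(2 * (π : ℂ) * Complex.I) * (⟪y, ξ⟫ : ℝ) * ec (-⟪y, s • ξ⟫))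
      (x₀ := t) (s := univ) (bound := fun _ => 2 * π * (R * ‖ξ‖)) Filter.univ_mem
      (Filter.Eventually.of_forall fun s => Continuous.aestronglyMeasurable (by fun_prop))
      ((integrable_const (1 : ℝ)).mono' (Continuous.aestronglyMeasurable (by fun_prop))
        (Filter.Eventually.of_forall fun y => (norm_ec _).le))
      (Continuous.aestronglyMeasurable (by fun_prop))
      (by
        filter_upwards [hsupp] with y hy s _
        rw [norm_mul, norm_ec, mul_one, norm_mul, Complex.norm_real]
        have e1 : ‖-(2 * (π : ℂ) * Complex.I)‖ = 2 * π := by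
          simp [abs_of_pos Real.pi_pos]
        rw [e1]
        gcongr
        refine (norm_inner_le_norm _ _).trans ?_
        gcongr)
      (integrable_const _)
      (Filter.Eventually.of_forall fun y s _ => hd1 y s)
    have e : (fun s : ℝ => mFT μ (s • ξ)) = fun s : ℝ => ∫ y, ec (-⟪y, s • ξ⟫) ∂μ := by
      ext s; exact mFT_eq μ _
    have ht' : (t : ℂ) ≠ 0 := by exact_mod_cast ht.ne'
    have hintk : ∀ k, Integrable (fun y => ((ξ k : ℝ) : ℂ) * (h k y * ec (-⟪y, t • ξ⟫))) μ := by
      intro k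
      obtain ⟨K, hK⟩ := schwartz_bdd (h k)
      have hc := (h k).continuous
      refine Integrable.const_mul ((integrable_const K).mono'
        (Continuous.aestronglyMeasurable (by fun_prop))
        (Filter.Eventually.of_forall fun y => ?_)) _
      rw [norm_mul, norm_ec, mul_one]; exact hK y
    have e3 : (∑ k, (((t • ξ) k : ℝ) : ℂ) * wFT μ (h k) (t • ξ)) =
        t * ∫ y, (⟪y, ξ⟫ : ℝ) * ec (-⟪y, t • ξ⟫) ∂μ := by
      have e4 : ∫ y, ((⟪y, ξ⟫ : ℝ) : ℂ) * ec (-⟪y, t • ξ⟫) ∂μ =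
          ∫ y, ∑ k, ((ξ k : ℝ) : ℂ) * (h k y * ec (-⟪y, t • ξ⟫)) ∂μ := by
        apply integral_congr_ae
        filter_upwards [hsupp] with y hy
        rw [PiLp.inner_apply]
        push_cast
        rw [Finset.sum_mul]
        refine Finset.sum_congr rfl fun k _ => ?_
        rw [hh, hχ1 y hy]
        simp
        ring
      rw [e4, integral_finsetSum _ (fun k _ => hintk k), Finset.mul_sum]
      refine Finset.sum_congr rfl fun k _ => ?_
      rw [integral_const_mul, wFT]
      simp
      ring
    have e5 : (-(2 * (π : ℂ) * Complex.I) *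
        ∑ k, (((t • ξ) k : ℝ) : ℂ) * wFT μ (h k) (t • ξ)) / (t : ℂ) =
        ∫ y, -(2 * (π : ℂ) * Complex.I) * (⟪y, ξ⟫ : ℝ) * ec (-⟪y, t • ξ⟫) ∂μ := by
      rw [e3]
      simp_rw [mul_assoc (-(2 * (π : ℂ) * Complex.I))]
      rw [integral_const_mul]
      field_simp
    rw [e]
    show HasDerivAt _ ((-(2 * (π : ℂ) * Complex.I) *
        ∑ k, (((t • ξ) k : ℝ) : ℂ) * wFT μ (h k) (t • ξ)) / (t : ℂ)) t
    rw [e5]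
    exact hder.2


/-- Standard smooth bump: `1` on the unit ball, `0` outside the ball of radius 2. -/
def bb (d : ℕ) : ContDiffBump (0 : EE d) := ⟨1, 2, one_pos, one_lt_two⟩

lemma bb_one {ζ : EE d} (h : ‖ζ‖ ≤ 1) : bb d ζ = 1 :=
  (bb d).one_of_mem_closedBall (by simpa [bb] using h)

lemma bb_zero {ζ : EE d} (h : 2 ≤ ‖ζ‖) : bb d ζ = 0 :=
  (bb d).zero_of_le_dist (by simpa [bb] using h)

/-- Annular cut-off. -/
def etaF (ζ : EE d) : ℝ := bb d ((1/2 : ℝ) • ζ) - bb d ζ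

/-- Radial derivative of the annular cut-off. -/
def detaF (ζ : EE d) : ℝ := fderiv ℝ (etaF (d := d)) ζ ζ

lemma etaF_contDiff : ContDiff ℝ (⊤ : ℕ∞) (etaF (d := d)) := by
  unfold etaF
  have h1 : ContDiff ℝ (⊤ : ℕ∞) (bb d) := (bb d).contDiff
  exact (h1.comp (contDiff_const_smul _)).sub h1

lemma etaF_low {ζ : EE d} (h : ‖ζ‖ < 1) : etaF ζ = 0 := by
  unfold etaF
  rw [bb_one h.le, bb_one, sub_self]
  rw [norm_smul]; norm_num; linarith [norm_nonneg ζ]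

lemma etaF_high {ζ : EE d} (h : 4 < ‖ζ‖) : etaF ζ = 0 := by
  unfold etaF
  rw [bb_zero, bb_zero, sub_self]
  · linarith
  · rw [norm_smul]; norm_num; linarith

lemma etaF_abs (ζ : EE d) : |etaF ζ| ≤ 1 := by
  unfold etaF
  have h1 := (bb d).nonneg (x := ζ)
  have h2 := (bb d).le_one (x := ζ)
  have h3 := (bb d).nonneg (x := (1/2 : ℝ) • ζ)
  have h4 := (bb d).le_one (x := (1/2 : ℝ) • ζ)
  rw [abs_le]; constructor <;> linarith

lemma detaF_low {ζ : EE d} (h : ‖ζ‖ < 1) : detaF ζ = 0 := by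
  unfold detaF
  have : (etaF (d := d)) =ᶠ[nhds ζ] fun _ => 0 := by
    have : ∀ᶠ z : EE d in nhds ζ, ‖z‖ < 1 := continuous_norm.continuousAt.eventually_lt
      continuousAt_const h
    filter_upwards [this] with z hz using etaF_low hz
  rw [this.fderiv_eq]; simp

lemma detaF_high {ζ : EE d} (h : 4 < ‖ζ‖) : detaF ζ = 0 := by
  unfold detaF
  have : (etaF (d := d)) =ᶠ[nhds ζ] fun _ => 0 := by
    have : ∀ᶠ z : EE d in nhds ζ, 4 < ‖z‖ := continuousAt_const.eventually_lt
      continuous_norm.continuousAt h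
    filter_upwards [this] with z hz using etaF_high hz
  rw [this.fderiv_eq]; simp

lemma detaF_continuous : Continuous (detaF (d := d)) := by
  unfold detaF
  have := (etaF_contDiff (d := d)).continuous_fderiv (by simp)
  exact this.clm_apply continuous_id

lemma detaF_bdd : ∃ E : ℝ, 0 ≤ E ∧ ∀ ζ : EE d, |detaF ζ| ≤ E := by
  obtain ⟨E, hE⟩ := (isCompact_closedBall (0 : EE d) 4).exists_bound_of_continuousOn
    (detaF_continuous (d := d)).continuousOn
  refine ⟨max E 0, le_max_right _ _, fun ζ => ?_⟩
  rcases le_or_gt ‖ζ‖ 4 with h | h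
  · exact (hE ζ (by simpa using h)).trans (le_max_left _ _)
  · rw [detaF_high h]; simp

lemma etaF_hasDerivAt (ζ : EE d) {t : ℝ} (ht : 0 < t) :
    HasDerivAt (fun s : ℝ => etaF (s • ζ)) (detaF (t • ζ) / t) t := by
  have h1 : HasFDerivAt (etaF (d := d)) (fderiv ℝ etaF (t • ζ)) (t • ζ) :=
    ((etaF_contDiff (d := d)).differentiable (by simp) _).hasFDerivAt
  have h2 : HasDerivAt (fun s : ℝ => s • ζ) ζ t := by
    simpa using (hasDerivAt_id t).smul_const ζ
  have h3 := h1.comp_hasDerivAt t h2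
  have e : detaF (t • ζ) / t = fderiv ℝ etaF (t • ζ) ζ := by
    unfold detaF
    rw [map_smul, smul_eq_mul]; field_simp
  rw [e]; exact h3

/-- Low-pass multiplier at frequency `2 ^ j`. -/
def mA (μ : Measure (EE d)) (j : ℕ) (ξ : EE d) : ℂ :=
  mFT μ ξ * ((bb d (((2:ℝ) ^ j)⁻¹ • ξ) : ℝ) : ℂ)

/-- Frequency-localized multiplier. -/
def mT (μ : Measure (EE d)) (j : ℕ) (ξ : EE d) : ℂ :=
  mFT μ ξ * ((etaF (((2:ℝ) ^ j)⁻¹ • ξ) : ℝ) : ℂ)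

lemma mT_eq (μ : Measure (EE d)) (j : ℕ) (ξ : EE d) : mT μ j ξ = mA μ (j+1) ξ - mA μ j ξ := by
  unfold mT mA etaF
  rw [smul_smul]
  have : (1/2 : ℝ) * ((2:ℝ)^j)⁻¹ = ((2:ℝ)^(j+1))⁻¹ := by
    rw [pow_succ, mul_inv]; ring
  rw [this]; push_cast; ring

lemma mA_continuous (μ : Measure (EE d)) [IsFiniteMeasure μ] (j : ℕ) : Continuous (mA μ j) := by
  unfold mA
  have h1 := mFT_continuous μ
  have h2 : Continuous (bb d) := (bb d).continuous
  fun_prop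

lemma mT_continuous (μ : Measure (EE d)) [IsFiniteMeasure μ] (j : ℕ) : Continuous (mT μ j) := by
  have : mT μ j = fun ξ => mA μ (j+1) ξ - mA μ j ξ := by ext ξ; exact mT_eq μ j ξ
  rw [this]
  exact (mA_continuous μ _).sub (mA_continuous μ _)

lemma mA_bdd (μ : Measure (EE d)) [IsFiniteMeasure μ] (j : ℕ) (ξ : EE d) :
    ‖mA μ j ξ‖ ≤ μ.real univ := by
  unfold mA
  rw [norm_mul, Complex.norm_real, Real.norm_of_nonneg (bb d).nonneg]
  calc _ ≤ μ.real univ * 1 := by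
        gcongr
        · exact (bb d).nonneg
        · exact norm_mFT_le μ ξ
        · exact (bb d).le_one
    _ = _ := mul_one _

lemma mT_bdd (μ : Measure (EE d)) [IsFiniteMeasure μ] (j : ℕ) (ξ : EE d) :
    ‖mT μ j ξ‖ ≤ μ.real univ := by
  unfold mT
  rw [norm_mul, Complex.norm_real]
  calc _ ≤ μ.real univ * 1 := by
        gcongr
        · exact norm_mFT_le μ ξ
        · exact etaF_abs _
    _ = _ := mul_one _

lemma mT_L2 (μ : Measure (EE d)) [IsFiniteMeasure μ] (hd : 1 ≤ d) {a C1 R : ℝ} (ha : 0 < a)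
    (hC1 : 0 < C1) (hdecay : ∀ ξ : EE d, ‖mFT μ ξ‖ ≤ C1 * (1 + ‖ξ‖) ^ (-a))
    (hR : 0 < R) (hsupp : ∀ᵐ y ∂μ, ‖y‖ ≤ R) :
    ∃ C3 : ℝ, 0 < C3 ∧ ∀ (j : ℕ) (f : SchwartzMap (EE d) ℂ),
      ∫⁻ x, multStar (mT μ j) f x ^ 2 ≤
        ENNReal.ofReal (C3 * ((2:ℝ) ^ j) ^ (1 - 2 * a)) * ∫⁻ x, ‖f x‖ₑ ^ 2 := by
  obtain ⟨ν, C2, hC2, hνc, hν, hνd⟩ := mFT_radial μ ha hC1 hdecay hR hsupp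
  obtain ⟨E, hE0, hE⟩ := detaF_bdd (d := d)
  refine ⟨3 * (C1 ^ 2 + (4 * C2 + C1 * E) ^ 2), by positivity, fun j f => ?_⟩
  set ρ : ℝ := (2:ℝ) ^ j with hρdef
  have hρ : 0 < ρ := by positivity
  let D : EE d → ℂ := fun ξ => ν ξ * ((etaF (ρ⁻¹ • ξ) : ℝ) : ℂ) +
    mFT μ ξ * ((detaF (ρ⁻¹ • ξ) : ℝ) : ℂ)
  have hns : ∀ ξ : EE d, ‖ρ⁻¹ • ξ‖ = ‖ξ‖ / ρ := fun ξ => by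
    rw [norm_smul, norm_inv, Real.norm_of_nonneg hρ.le]; field_simp
  have hl1 : ∀ ξ : EE d, ‖ξ‖ < ρ → ‖ρ⁻¹ • ξ‖ < 1 := fun ξ h => by
    rw [hns, div_lt_one hρ]; exact h
  have hh1 : ∀ ξ : EE d, 4 * ρ < ‖ξ‖ → 4 < ‖ρ⁻¹ • ξ‖ := fun ξ h => by
    rw [hns, lt_div_iff₀ hρ]; exact h
  have hlow : ∀ ξ, ‖ξ‖ < ρ → mT μ j ξ = 0 := fun ξ h => by
    unfold mT; rw [etaF_low (hl1 ξ h)]; simp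
  have hhigh : ∀ ξ, 4 * ρ < ‖ξ‖ → mT μ j ξ = 0 := fun ξ h => by
    unfold mT; rw [etaF_high (hh1 ξ h)]; simp
  have hlow' : ∀ ξ, ‖ξ‖ < ρ → D ξ = 0 := fun ξ h => by
    simp only [D]; rw [etaF_low (hl1 ξ h), detaF_low (hl1 ξ h)]; simp
  have hhigh' : ∀ ξ, 4 * ρ < ‖ξ‖ → D ξ = 0 := fun ξ h => by
    simp only [D]; rw [etaF_high (hh1 ξ h), detaF_high (hh1 ξ h)]; simp
  have hpow : ∀ ξ : EE d, ρ ≤ ‖ξ‖ → (1 + ‖ξ‖) ^ (-a) ≤ ρ ^ (-a) := fun ξ h =>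
    Real.rpow_le_rpow_of_nonpos hρ (by linarith) (by linarith)
  have hmα : ∀ ξ, ‖mT μ j ξ‖ ≤ C1 * ρ ^ (-a) := by
    intro ξ
    rcases lt_or_ge ‖ξ‖ ρ with h | h
    · rw [hlow ξ h]; simp; positivity
    · unfold mT
      rw [norm_mul, Complex.norm_real]
      calc _ ≤ (C1 * ρ ^ (-a)) * 1 := by
            gcongr
            · exact (hdecay ξ).trans (mul_le_mul_of_nonneg_left (hpow ξ h) hC1.le)
            · exact etaF_abs _
        _ = _ := mul_one _
  have hDβ : ∀ ξ, ‖D ξ‖ ≤ (4 * C2 + C1 * E) * ρ ^ (1 - a) := by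
    intro ξ
    have hr : ρ ^ (1 - a) = ρ * ρ ^ (-a) := by
      rw [sub_eq_add_neg, Real.rpow_add hρ, Real.rpow_one]
    rcases lt_or_ge ‖ξ‖ ρ with h | h
    · rw [hlow' ξ h]; simp; positivity
    rcases lt_or_ge (4 * ρ) ‖ξ‖ with h' | h'
    · rw [hhigh' ξ h']; simp; positivity
    have hρ1 : 1 ≤ ρ := one_le_pow₀ (by norm_num)
    calc ‖D ξ‖ ≤ ‖ν ξ‖ * |etaF (ρ⁻¹ • ξ)| + ‖mFT μ ξ‖ * |detaF (ρ⁻¹ • ξ)| := by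
          refine (norm_add_le _ _).trans ?_
          rw [norm_mul, norm_mul, Complex.norm_real, Complex.norm_real]; rfl
      _ ≤ (C2 * (4 * ρ) * ρ ^ (-a)) * 1 + (C1 * ρ ^ (-a)) * E := by
          gcongr
          · refine (hν ξ).trans ?_
            exact mul_le_mul (mul_le_mul_of_nonneg_left h' hC2) (hpow ξ h) (by positivity)
              (by positivity)
          · exact etaF_abs _
          · exact (hdecay ξ).trans (mul_le_mul_of_nonneg_left (hpow ξ h) hC1.le)
          · exact hE _
      _ ≤ (C2 * (4 * ρ) * ρ ^ (-a)) * 1 + (C1 * ρ ^ (-a)) * E * ρ := by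
          have : 0 ≤ (C1 * ρ ^ (-a)) * E := by positivity
          nlinarith
      _ = _ := by rw [hr]; ring
  have hηc := (etaF_contDiff (d := d)).continuous
  have hdηc := detaF_continuous (d := d)
  have hmc := mFT_continuous μ
  have hDc : Continuous D := by simp only [D]; fun_prop
  have hder : ∀ (ξ : EE d) (t : ℝ), 0 < t →
      HasDerivAt (fun s : ℝ => mT μ j (s • ξ)) (D (t • ξ) / t) t := by
    intro ξ t ht
    have h1 := hνd ξ t ht
    have h2 := (etaF_hasDerivAt (ρ⁻¹ • ξ) ht).ofReal_comp
    have h3 := h1.mul h2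
    have e1 : (fun s : ℝ => mT μ j (s • ξ)) =
        (fun s : ℝ => mFT μ (s • ξ)) * fun s : ℝ => ((etaF (s • ρ⁻¹ • ξ) : ℝ) : ℂ) := by
      ext s; simp only [mT, Pi.mul_apply]; rw [smul_comm]
    have e2 : D (t • ξ) / t = ν (t • ξ) / t * ((etaF (t • ρ⁻¹ • ξ) : ℝ) : ℂ) +
        mFT μ (t • ξ) * ((detaF (t • ρ⁻¹ • ξ) / t : ℝ) : ℂ) := by
      simp only [D]; rw [smul_comm ρ⁻¹ t]; push_cast; ring
    rw [e1, e2]; exact h3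
  refine (multStar_L2 (mT_continuous μ j) hDc hmα hDβ hder hd hρ hlow hhigh hlow' hhigh' hρ f).trans
    (le_of_eq ?_)
  congr 2
  have r1 : ρ ^ (1 - 2 * a) = ρ * (ρ ^ (-a)) ^ 2 := by
    rw [← Real.rpow_natCast, ← Real.rpow_mul hρ.le]
    nth_rw 2 [← Real.rpow_one ρ]
    rw [← Real.rpow_add hρ]; congr 1; push_cast; ring
  have r2 : ρ ^ (1 - a) = ρ * ρ ^ (-a) := by
    rw [sub_eq_add_neg, Real.rpow_add hρ, Real.rpow_one]
  rw [r1, r2]; field_simp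


/-- The bump as a Schwartz function. -/
def bbS (d : ℕ) : SchwartzMap (EE d) ℂ :=
  ((bb d).hasCompactSupport.comp_left (g := Complex.ofReal) Complex.ofReal_zero).toSchwartzMap
    (Complex.ofRealCLM.contDiff.comp (bb d).contDiff)

lemma bbS_apply (ζ : EE d) : bbS d ζ = ((bb d ζ : ℝ) : ℂ) := rfl

/-- Kernel of the low-pass filter. -/
def phiS (d : ℕ) : SchwartzMap (EE d) ℂ := 𝓕⁻ (bbS d)

lemma bb_eq_integral (ζ : EE d) : ((bb d ζ : ℝ) : ℂ) = ∫ z, phiS d z * ec (-⟪z, ζ⟫) := by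
  have h1 : bbS d = 𝓕 (phiS d) := by
    unfold phiS; rw [FourierTransform.fourier_fourierInv_eq]
  rw [← bbS_apply, h1, SchwartzMap.fourier_coe, Real.fourier_eq']
  congr 1; ext z
  rw [smul_eq_mul, ec, mul_comm]
  congr 2; push_cast; ring

lemma mA_kernel (μ : Measure (EE d)) [IsFiniteMeasure μ] (j : ℕ) (ξ : EE d) :
    mA μ j ξ = ∫ p : EE d × EE d, phiS d p.2 * ec (-⟪p.1 + ((2:ℝ)^j)⁻¹ • p.2, ξ⟫)
      ∂(μ.prod volume) := by
  unfold mA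
  rw [bb_eq_integral, mFT_eq, ← integral_prod_mul]
  congr 1; ext p
  rw [inner_add_left, neg_add, ec_add, inner_smul_left, inner_smul_right]
  simp
  ring

lemma mult_mA_kernel (μ : Measure (EE d)) [IsFiniteMeasure μ] (j : ℕ) (t : ℝ)
    (f : SchwartzMap (EE d) ℂ) (x : EE d) :
    mult (mA μ j) t f x = ∫ p : EE d × EE d,
      phiS d p.2 * f (x - t • (p.1 + ((2:ℝ)^j)⁻¹ • p.2)) ∂(μ.prod volume) := by
  have hf := (𝓕 f).continuous
  have hφ := (phiS d).continuous
  set δ : ℝ := ((2:ℝ)^j)⁻¹ with hδ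
  have e1 : mult (mA μ j) t f x = ∫ ξ, ∫ p : EE d × EE d,
      ec ⟪x - t • (p.1 + δ • p.2), ξ⟫ * (𝓕 f ξ * phiS d p.2) ∂(μ.prod volume) := by
    unfold mult
    congr 1; ext ξ
    rw [mA_kernel, mul_left_comm, mul_comm, ← integral_const_mul]
    congr 1; ext p
    rw [inner_sub_left, sub_eq_add_neg, ec_add, inner_smul_right, inner_smul_left]
    simp
    ring
  rw [e1, integral_integral_swap]
  · congr 1; ext p
    rw [schwartz_inversion f, ← integral_const_mul]
    congr 1; ext ξ; ring
  · have h1 : Integrable (fun p : EE d × EE d => (1 : ℂ) * phiS d p.2) (μ.prod volume) :=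
      (integrable_const (1:ℂ)).mul_prod (phiS d).integrable
    simp only [one_mul] at h1
    have h2 := ((𝓕 f).integrable (μ := volume)).mul_prod h1
    exact h2.bdd_mul (c := 1) (f := fun q : EE d × (EE d × EE d) =>
        ec ⟪x - t • (q.2.1 + δ • q.2.2), q.1⟫) (Continuous.aestronglyMeasurable (by fun_prop))
      (Filter.Eventually.of_forall fun ξ => (norm_ec _).le)

lemma mult_mA_le (μ : Measure (EE d)) [IsFiniteMeasure μ] (j : ℕ) (t : ℝ)
    (f : SchwartzMap (EE d) ℂ) (x : EE d) :
    ‖mult (mA μ j) t f x‖ₑ ≤ ∫⁻ y, ∫⁻ z,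
      ‖phiS d z‖ₑ * ‖f (x - t • (y + ((2:ℝ)^j)⁻¹ • z))‖ₑ ∂volume ∂μ := by
  have hf := f.continuous
  have hφ := (phiS d).continuous
  rw [mult_mA_kernel]
  refine (enorm_integral_le_lintegral_enorm _).trans (le_of_eq ?_)
  rw [lintegral_prod _ (Continuous.aemeasurable (by fun_prop))]
  simp_rw [enorm_mul]

lemma multStar_mA_Linf (μ : Measure (EE d)) [IsFiniteMeasure μ] :
    ∃ K : ℝ, 0 < K ∧ ∀ (j : ℕ) (f : SchwartzMap (EE d) ℂ) (M : ℝ≥0∞),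
      (∀ y, ‖f y‖ₑ ≤ M) → ∀ x, multStar (mA μ j) f x ≤ ENNReal.ofReal K * M := by
  have hI : ∫⁻ z, ‖phiS d z‖ₑ ≠ ⊤ := (phiS d).integrable.2.ne
  have hJ : (∫⁻ z, ‖phiS d z‖ₑ) * μ univ ≠ ⊤ := ENNReal.mul_ne_top hI (measure_ne_top _ _)
  refine ⟨((∫⁻ z, ‖phiS d z‖ₑ) * μ univ).toReal + 1, by positivity, fun j f M hM x => ?_⟩
  refine iSup_le fun t => (mult_mA_le μ j t f x).trans ?_
  have hφ := (phiS d).continuous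
  calc _ ≤ ∫⁻ y, ∫⁻ z, ‖phiS d z‖ₑ * M ∂volume ∂μ := by
        gcongr; exact hM _
    _ = (∫⁻ z, ‖phiS d z‖ₑ) * μ univ * M := by
        rw [lintegral_mul_const _ (Continuous.measurable (by fun_prop)), lintegral_const]; ring
    _ ≤ _ := by
        gcongr
        rw [← ENNReal.ofReal_toReal hJ]
        apply ENNReal.ofReal_le_ofReal
        rw [ENNReal.toReal_ofReal (by positivity)]; linarith

lemma lint_affine (G : EE d → ℝ≥0∞) (v : EE d) {c : ℝ} (hc : c ≠ 0) :
    ∫⁻ z, G (v + c • z) = ENNReal.ofReal ((|c| ^ d)⁻¹) * ∫⁻ w, G w := by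
  have h1 : ∫⁻ z, G (v + c • z) = ∫⁻ w, G (v + w) ∂(Measure.map (c • ·) (volume : Measure (EE d))) :=
    ((Homeomorph.smulOfNeZero (α := EE d) c hc).measurableEmbedding.lintegral_map
      (fun w => G (v + w))).symm
  rw [h1, Measure.map_addHaar_smul _ hc, lintegral_smul_measure, lintegral_add_left_eq_self]
  simp [abs_pow, abs_inv]

lemma phi_dyadic (d : ℕ) : ∃ K : ℝ, 0 < K ∧ ∀ z : EE d,
    ‖phiS d z‖ₑ ≤ ∑' k : ℕ, ENNReal.ofReal (K * (((2:ℝ)^k) ^ (2*d+1))⁻¹) *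
      (ball (0 : EE d) (2^k)).indicator 1 z := by
  obtain ⟨K0, hK0, h0⟩ := (phiS d).decay 0 0
  obtain ⟨K1, hK1, h1⟩ := (phiS d).decay (2*d+1) 0
  refine ⟨K0 + K1 * 2 ^ (2*d+1), by positivity, fun z => ?_⟩
  have h0' : ‖phiS d z‖ ≤ K0 := by simpa using h0 z
  have h1' : ‖z‖ ^ (2*d+1) * ‖phiS d z‖ ≤ K1 := by simpa using h1 z
  obtain ⟨k, hk, hb⟩ : ∃ k : ℕ, ‖z‖ < 2^k ∧
      ‖phiS d z‖ ≤ (K0 + K1 * 2 ^ (2*d+1)) * (((2:ℝ)^k) ^ (2*d+1))⁻¹ := by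
    rcases lt_or_ge ‖z‖ 1 with h | h
    · refine ⟨0, by simpa using h, ?_⟩
      simp only [pow_zero, one_pow, inv_one, mul_one]
      have : 0 ≤ K1 * 2 ^ (2*d+1) := by positivity
      linarith
    · obtain ⟨n, hn1, hn2⟩ := exists_nat_pow_near h (one_lt_two (α := ℝ))
      refine ⟨n+1, hn2, ?_⟩
      have h2 : ((2:ℝ)^n) ^ (2*d+1) * ‖phiS d z‖ ≤ K1 := le_trans (by gcongr) h1'
      rw [← div_eq_mul_inv, le_div_iff₀ (by positivity), pow_succ (2:ℝ) n, mul_pow]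
      have : 0 ≤ (2:ℝ) ^ (2*d+1) := by positivity
      nlinarith
  refine le_trans ?_ (ENNReal.le_tsum k)
  rw [indicator_of_mem (by simpa using hk), Pi.one_apply, mul_one, ← ofReal_norm]
  exact ENNReal.ofReal_le_ofReal hb

lemma ball_piece (μ : Measure (EE d)) [IsFiniteMeasure μ] {b C4 R : ℝ} (hC4 : 0 < C4)
    (hfro : ∀ (x : EE d) (r : ℝ), 0 < r → μ (ball x r) ≤ ENNReal.ofReal (C4 * r ^ b))
    (hR : 0 < R) (hsupp : ∀ᵐ y ∂μ, ‖y‖ ≤ R) {δ r t : ℝ} (hδ : 0 < δ) (hδ1 : δ ≤ 1) (hr : 1 ≤ r)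
    (ht : 0 < t) (f : SchwartzMap (EE d) ℂ) (x : EE d) :
    ∫⁻ y, ∫⁻ z, (ball (0 : EE d) r).indicator 1 z * ‖f (x - t • (y + δ • z))‖ₑ ∂volume ∂μ ≤
      ENNReal.ofReal ((δ ^ d)⁻¹ * (C4 * (δ * r) ^ b) * ((R + 1) * r) ^ d) *
        HL (fun x => ‖f x‖ₑ) x := by
  have hf := f.continuous
  have hr0 : 0 < r := by linarith
  set s : ℝ := (R + 1) * r with hs
  have hs0 : 0 < s := by positivity
  have step1 : ∀ y : EE d,
      ∫⁻ z, (ball (0 : EE d) r).indicator 1 z * ‖f (x - t • (y + δ • z))‖ₑ =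
      ENNReal.ofReal ((δ ^ d)⁻¹) *
        ∫⁻ w, (ball w (δ * r)).indicator 1 y * ‖f (x - t • w)‖ₑ := by
    intro y
    have := lint_affine (fun w => (ball w (δ * r)).indicator 1 y * ‖f (x - t • w)‖ₑ) y hδ.ne'
    rw [abs_of_pos hδ] at this
    rw [← this]
    congr 1; ext z
    congr 1
    have : z ∈ ball (0 : EE d) r ↔ y ∈ ball (y + δ • z) (δ * r) := by
      rw [mem_ball_zero_iff, mem_ball', dist_eq_norm, add_sub_cancel_left, norm_smul,
        Real.norm_of_nonneg hδ.le]
      exact (mul_lt_mul_iff_right₀ hδ).symm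
    by_cases hz : z ∈ ball (0 : EE d) r
    · rw [indicator_of_mem hz, indicator_of_mem (this.1 hz)]; rfl
    · rw [indicator_of_notMem hz, indicator_of_notMem (fun h => hz (this.2 h))]
  have hmeas : MeasurableSet {q : EE d × EE d | q.1 ∈ ball q.2 (δ * r)} := by
    have : IsOpen {q : EE d × EE d | dist q.1 q.2 < δ * r} :=
      isOpen_lt (by fun_prop) (by fun_prop)
    exact this.measurableSet
  have hm2 : Measurable (fun q : EE d × EE d =>
      (ball q.2 (δ * r)).indicator (1 : EE d → ℝ≥0∞) q.1 * ‖f (x - t • q.2)‖ₑ) := by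
    refine Measurable.mul ?_ (Continuous.measurable (by fun_prop))
    have : (fun q : EE d × EE d => (ball q.2 (δ * r)).indicator (1 : EE d → ℝ≥0∞) q.1) =
        {q : EE d × EE d | q.1 ∈ ball q.2 (δ * r)}.indicator 1 := by
      ext q; simp only [indicator, mem_ofPred_eq]; rfl
    rw [this]
    exact measurable_one.indicator hmeas
  simp_rw [step1]
  rw [lintegral_const_mul' _ _ ENNReal.ofReal_ne_top, lintegral_lintegral_swap hm2.aemeasurable]
  have step2 : ∀ w : EE d, ∫⁻ y, (ball w (δ * r)).indicator 1 y * ‖f (x - t • w)‖ₑ ∂μ ≤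
      ENNReal.ofReal (C4 * (δ * r) ^ b) * ((ball x (t * s)).indicator (fun v => ‖f v‖ₑ)
        (x + (-t) • w)) := by
    intro w
    have e : x + (-t) • w = x - t • w := by rw [neg_smul, sub_eq_add_neg]
    rw [lintegral_mul_const _ (measurable_one.indicator measurableSet_ball),
      lintegral_indicator_one measurableSet_ball, e]
    rcases lt_or_ge ‖w‖ s with h | h
    · rw [indicator_of_mem]
      · gcongr
        exact hfro w _ (by positivity)
      · rw [mem_ball, dist_eq_norm, sub_sub_cancel_left, norm_neg, norm_smul,
          Real.norm_of_nonneg ht.le]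
        gcongr
    · have : μ (ball w (δ * r)) = 0 := by
        refine measure_mono_null (t := {y | ¬ ‖y‖ ≤ R}) (fun y hy => ?_) hsupp
        rw [mem_ball', dist_eq_norm] at hy
        simp only [mem_ofPred_eq, not_le]
        have h1 : ‖w‖ ≤ ‖w - y‖ + ‖y‖ := by simpa using norm_add_le (w - y) y
        have h2 : δ * r ≤ r := by nlinarith
        have h3 : R ≤ R * r := by nlinarith
        have : s = R * r + r := by rw [hs]; ring
        linarith
      rw [this, zero_mul]; exact bot_le
  calc _ ≤ ENNReal.ofReal ((δ ^ d)⁻¹) * ∫⁻ w, ENNReal.ofReal (C4 * (δ * r) ^ b) *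
        ((ball x (t * s)).indicator (fun v => ‖f v‖ₑ) (x + (-t) • w)) := by
        gcongr with w; exact step2 w
    _ = ENNReal.ofReal ((δ ^ d)⁻¹) * (ENNReal.ofReal (C4 * (δ * r) ^ b) *
        (ENNReal.ofReal ((t ^ d)⁻¹) * ∫⁻ v in ball x (t * s), ‖f v‖ₑ)) := by
        rw [lintegral_const_mul' _ _ ENNReal.ofReal_ne_top,
          lint_affine (fun v => (ball x (t * s)).indicator (fun v => ‖f v‖ₑ) v) x
            (neg_ne_zero.2 ht.ne'),
          lintegral_indicator measurableSet_ball, abs_neg, abs_of_pos ht]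
    _ ≤ ENNReal.ofReal ((δ ^ d)⁻¹) * (ENNReal.ofReal (C4 * (δ * r) ^ b) *
        (ENNReal.ofReal ((t ^ d)⁻¹) * (ENNReal.ofReal ((t * s) ^ d) * HL (fun x => ‖f x‖ₑ) x))) := by
        gcongr
        exact le_HL _ x (by positivity)
    _ = _ := by
        rw [← mul_assoc, ← mul_assoc, ← mul_assoc, ← ENNReal.ofReal_mul (by positivity),
          ← ENNReal.ofReal_mul (by positivity), ← ENNReal.ofReal_mul (by positivity)]
        congr 2
        rw [mul_pow t s]; field_simp

lemma multStar_mA_HL (μ : Measure (EE d)) [IsFiniteMeasure μ] {b C4 R : ℝ} (hC4 : 0 < C4)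
    (hb : b ≤ d)
    (hfro : ∀ (x : EE d) (r : ℝ), 0 < r → μ (ball x r) ≤ ENNReal.ofReal (C4 * r ^ b))
    (hR : 0 < R) (hsupp : ∀ᵐ y ∂μ, ‖y‖ ≤ R) :
    ∃ K : ℝ, 0 < K ∧ ∀ (j : ℕ) (f : SchwartzMap (EE d) ℂ) (x : EE d),
      multStar (mA μ j) f x ≤ ENNReal.ofReal (K * ((2:ℝ)^j) ^ ((d:ℝ) - b)) *
        HL (fun x => ‖f x‖ₑ) x := by
  obtain ⟨K, hK, hφd⟩ := phi_dyadic d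
  refine ⟨2 * (K * C4 * (R + 1) ^ d), by positivity, fun j f x => iSup_le fun ⟨t, ht⟩ => ?_⟩
  refine (mult_mA_le μ j t f x).trans ?_
  set ρ : ℝ := (2:ℝ)^j with hρ
  have hρ1 : 1 ≤ ρ := one_le_pow₀ (by norm_num)
  have hρ0 : 0 < ρ := by positivity
  set H := HL (fun x => ‖f x‖ₑ) x
  have hf := f.continuous
  have hm : ∀ k : ℕ, Measurable (fun q : EE d × EE d =>
      ENNReal.ofReal (K * (((2:ℝ)^k) ^ (2*d+1))⁻¹) *
      ((ball (0 : EE d) (2^k)).indicator (1 : EE d → ℝ≥0∞) q.2 *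
        ‖f (x - t • (q.1 + ρ⁻¹ • q.2))‖ₑ)) := by
    intro k
    refine Measurable.const_mul (Measurable.mul ?_ (Continuous.measurable (by fun_prop))) _
    exact (measurable_one.indicator measurableSet_ball).comp measurable_snd
  calc _ ≤ ∫⁻ y, ∫⁻ z, ∑' k : ℕ, ENNReal.ofReal (K * (((2:ℝ)^k) ^ (2*d+1))⁻¹) *
      ((ball (0 : EE d) (2^k)).indicator 1 z * ‖f (x - t • (y + ρ⁻¹ • z))‖ₑ) ∂volume ∂μ := by
        refine lintegral_mono fun y => lintegral_mono fun z => ?_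
        simp_rw [← mul_assoc]
        rw [ENNReal.tsum_mul_right]
        gcongr
        exact hφd z
    _ = ∑' k : ℕ, ENNReal.ofReal (K * (((2:ℝ)^k) ^ (2*d+1))⁻¹) * ∫⁻ y, ∫⁻ z,
      ((ball (0 : EE d) (2^k)).indicator 1 z * ‖f (x - t • (y + ρ⁻¹ • z))‖ₑ) ∂volume ∂μ := by
        have e1 : ∀ y : EE d, ∫⁻ z, ∑' k : ℕ, ENNReal.ofReal (K * (((2:ℝ)^k) ^ (2*d+1))⁻¹) *
            ((ball (0 : EE d) (2^k)).indicator 1 z * ‖f (x - t • (y + ρ⁻¹ • z))‖ₑ) =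
            ∑' k : ℕ, ∫⁻ z, ENNReal.ofReal (K * (((2:ℝ)^k) ^ (2*d+1))⁻¹) *
            ((ball (0 : EE d) (2^k)).indicator 1 z * ‖f (x - t • (y + ρ⁻¹ • z))‖ₑ) := fun y =>
          lintegral_tsum fun k => ((hm k).comp measurable_prodMk_left).aemeasurable
        simp_rw [e1]
        rw [lintegral_tsum fun k => ((hm k).lintegral_prod_right' (ν := volume)).aemeasurable]
        congr 1; ext k
        simp_rw [lintegral_const_mul' _ _ ENNReal.ofReal_ne_top]
    _ ≤ ∑' k : ℕ, ENNReal.ofReal (K * C4 * (R + 1) ^ d * ρ ^ ((d:ℝ) - b)) * H *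
        ENNReal.ofReal ((1/2)^k) := by
        refine ENNReal.tsum_le_tsum fun k => ?_
        have hr1 : (1:ℝ) ≤ 2^k := one_le_pow₀ (by norm_num)
        set r : ℝ := 2^k with hr
        have hr0 : 0 < r := by positivity
        refine (mul_le_mul_right (ball_piece μ hC4 hfro hR hsupp (inv_pos.2 hρ0)
          (inv_le_one_of_one_le₀ hρ1) hr1 ht f x) _).trans ?_
        rw [← mul_assoc, ← ENNReal.ofReal_mul (by positivity), mul_right_comm _ H,
          ← ENNReal.ofReal_mul (by positivity)]
        refine mul_le_mul_left (ENNReal.ofReal_le_ofReal ?_) H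
        have e1 : ((1:ℝ)/2)^k = r⁻¹ := by rw [hr]; simp
        have e2 : (ρ⁻¹ * r) ^ b = ρ ^ (-b) * r ^ b := by
          rw [Real.mul_rpow (by positivity) (by positivity), Real.inv_rpow hρ0.le,
            Real.rpow_neg hρ0.le]
        have e3 : r ^ b ≤ r ^ d := by
          rw [← Real.rpow_natCast]; exact Real.rpow_le_rpow_of_exponent_le hr1 hb
        have e4 : ρ ^ ((d:ℝ) - b) = ρ ^ d * ρ ^ (-b) := by
          rw [sub_eq_add_neg, Real.rpow_add hρ0, Real.rpow_natCast]
        have hρb : 0 < ρ ^ (-b) := by positivity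
        rw [e1, e2, e4]
        calc K * (r ^ (2*d+1))⁻¹ * (((ρ⁻¹) ^ d)⁻¹ * (C4 * (ρ ^ (-b) * r ^ b)) * ((R + 1) * r) ^ d)
            ≤ K * (r ^ (2*d+1))⁻¹ *
              (((ρ⁻¹) ^ d)⁻¹ * (C4 * (ρ ^ (-b) * r ^ d)) * ((R + 1) * r) ^ d) := by gcongr
          _ = _ := by
            rw [mul_pow, inv_pow, inv_inv]; field_simp; ring
    _ = _ := by
        rw [ENNReal.tsum_mul_left, ← ENNReal.ofReal_tsum_of_nonneg (fun k => by positivity)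
          summable_geometric_two, tsum_geometric_two, mul_right_comm,
          ← ENNReal.ofReal_mul (by positivity)]
        congr 2; ring


lemma schwartz_trunc (f : SchwartzMap (EE d) ℂ) {κ : ℝ} (hκ : 0 < κ) :
    ∃ g h : SchwartzMap (EE d) ℂ, f = g + h ∧
      (∀ x, ‖g x‖ ≤ ‖f x‖ ∧ (2 * κ < ‖f x‖ → g x = 0)) ∧
      (∀ x, ‖h x‖ ≤ ‖f x‖ ∧ (‖f x‖ ≤ κ → h x = 0)) := by
  let θ : ContDiffBump (0 : ℝ) := ⟨1, 4, one_pos, by norm_num⟩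
  have hθ : Function.HasTemperateGrowth (θ : ℝ → ℝ) :=
    (θ.hasCompactSupport.toSchwartzMap θ.contDiff).hasTemperateGrowth
  let ψ : EE d → ℝ := fun x => θ (κ⁻¹ ^ 2 * ‖f x‖ ^ 2)
  have hψ : Function.HasTemperateGrowth ψ := by
    refine hθ.comp ?_
    exact (Function.HasTemperateGrowth.const (κ⁻¹ ^ 2)).mul
      ((Function.hasTemperateGrowth_norm_sq ℂ).comp f.hasTemperateGrowth)
  let g := SchwartzMap.smulLeftCLM ℂ ψ f
  have hg : ∀ x, g x = ψ x • f x := fun x => SchwartzMap.smulLeftCLM_apply_apply hψ f x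
  have h0 : ∀ x, 0 ≤ ψ x := fun x => θ.nonneg
  have h1 : ∀ x, ψ x ≤ 1 := fun x => θ.le_one
  refine ⟨g, f - g, by abel, fun x => ⟨?_, fun hx => ?_⟩, fun x => ⟨?_, fun hx => ?_⟩⟩
  · rw [hg, norm_smul, Real.norm_of_nonneg (h0 x)]
    nlinarith [norm_nonneg (f x), h1 x]
  · have : ψ x = 0 := by
      refine θ.zero_of_le_dist ?_
      show 4 ≤ dist _ _
      rw [Real.dist_0_eq_abs, abs_of_nonneg (by positivity), ← mul_pow, inv_mul_eq_div]
      have : 2 ≤ ‖f x‖ / κ := by rw [le_div_iff₀ hκ]; exact hx.le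
      nlinarith
    rw [hg, this, zero_smul]
  · have : (f - g) x = (1 - ψ x) • f x := by
      rw [sub_apply, hg, sub_smul, one_smul]
    rw [this, norm_smul, Real.norm_of_nonneg (by linarith [h1 x])]
    nlinarith [norm_nonneg (f x), h0 x]
  · have : ψ x = 1 := by
      refine θ.one_of_mem_closedBall ?_
      rw [mem_closedBall, Real.dist_0_eq_abs, abs_of_nonneg (by positivity), ← mul_pow,
        inv_mul_eq_div]
      show _ ≤ (1:ℝ)
      have : ‖f x‖ / κ ≤ 1 := by rw [div_le_one hκ]; exact hx
      have h0 : 0 ≤ ‖f x‖ / κ := by positivity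
      nlinarith
    rw [sub_apply, hg, this, one_smul, sub_self]

lemma layer {g : EE d → ℝ≥0∞} (hg : Measurable g) (hfin : ∀ x, g x ≠ ⊤) {p : ℝ} (hp : 0 < p) :
    ∫⁻ x, g x ^ p = ENNReal.ofReal p * ∫⁻ t in Ioi (0:ℝ),
      volume {x | ENNReal.ofReal t < g x} * ENNReal.ofReal (t ^ (p - 1)) := by
  have := lintegral_rpow_eq_lintegral_meas_lt_mul (volume : Measure (EE d))
    (f := fun x => (g x).toReal) (Filter.Eventually.of_forall fun x => ENNReal.toReal_nonneg)
    hg.ennreal_toReal.aemeasurable hp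
  have e : ∀ x, g x ^ p = ENNReal.ofReal ((g x).toReal ^ p) := fun x => by
    rw [← ENNReal.ofReal_rpow_of_nonneg ENNReal.toReal_nonneg hp.le, ENNReal.ofReal_toReal (hfin x)]
  simp_rw [e]
  rw [this]
  congr 1
  refine setLIntegral_congr_fun measurableSet_Ioi fun t ht => ?_
  have : {x | t < (g x).toReal} = {x | ENNReal.ofReal t < g x} := by
    ext x
    simp only [mem_ofPred_eq]
    rw [ENNReal.ofReal_lt_iff_lt_toReal (le_of_lt ht) (hfin x)]
  simp only [this]

lemma high_int {u c q : ℝ} (hu : 0 ≤ u) (hc : 0 < c) (hq : 0 < q) :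
    ∫⁻ t in Ioi (0:ℝ), ENNReal.ofReal (t ^ (q - 1)) * (if c * t < u then 1 else 0) ≤
      ENNReal.ofReal ((u / c) ^ q / q) := by
  have hi : IntervalIntegrable (fun x : ℝ => x ^ (q-1)) volume 0 (u / c) :=
    intervalIntegral.intervalIntegrable_rpow' (by linarith)
  have hv : 0 ≤ u / c := by positivity
  calc _ ≤ ∫⁻ t in Ioi (0:ℝ), (Ioc 0 (u / c)).indicator (fun t => ENNReal.ofReal (t ^ (q - 1))) t := by
        refine setLIntegral_mono' measurableSet_Ioi fun t ht => ?_
        split_ifs with h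
        · rw [indicator_of_mem, mul_one]
          refine ⟨ht, ?_⟩
          rw [le_div_iff₀ hc]; linarith
        · simp
    _ ≤ ∫⁻ t, (Ioc 0 (u / c)).indicator (fun t => ENNReal.ofReal (t ^ (q - 1))) t :=
        setLIntegral_le_lintegral _ _
    _ = ENNReal.ofReal (∫ t in Ioc 0 (u / c), t ^ (q - 1)) := by
        rw [lintegral_indicator measurableSet_Ioc, ofReal_integral_eq_lintegral_ofReal]
        · exact (intervalIntegrable_iff_integrableOn_Ioc_of_le hv).1 hi
        · refine (ae_restrict_iff' measurableSet_Ioc).2 (Filter.Eventually.of_forall fun t ht => ?_)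
          exact Real.rpow_nonneg ht.1.le _
    _ = _ := by
        rw [← intervalIntegral.integral_of_le hv, integral_rpow (Or.inl (by linarith))]
        congr 1
        rw [sub_add_cancel, Real.zero_rpow hq.ne', sub_zero]

lemma low_int {u c q : ℝ} (hu : 0 < u) (hc : 0 < c) (hq : 0 < q) :
    ∫⁻ t in Ioi (0:ℝ), ENNReal.ofReal (t ^ (-q - 1)) * (if u ≤ c * t then 1 else 0) ≤
      ENNReal.ofReal ((u / c) ^ (-q) / q) := by
  have hv : 0 < u / c := by positivity
  calc _ ≤ ∫⁻ t, (Ici (u / c)).indicator (fun t => ENNReal.ofReal (t ^ (-q - 1))) t := by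
        refine le_trans (setLIntegral_mono' measurableSet_Ioi fun t ht => ?_)
          (setLIntegral_le_lintegral _ _)
        split_ifs with h
        · rw [indicator_of_mem, mul_one]
          rw [mem_Ici, div_le_iff₀ hc]; linarith
        · simp
    _ = ENNReal.ofReal (∫ t in Ioi (u / c), t ^ (-q - 1)) := by
        rw [lintegral_indicator measurableSet_Ici, setLIntegral_congr Ioi_ae_eq_Ici.symm,
          ofReal_integral_eq_lintegral_ofReal]
        · exact integrableOn_Ioi_rpow_of_lt (by linarith) hv
        · refine (ae_restrict_iff' measurableSet_Ioi).2 (Filter.Eventually.of_forall fun t ht => ?_)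
          exact Real.rpow_nonneg (hv.le.trans (le_of_lt ht)) _
    _ = _ := by
        rw [integral_Ioi_rpow_of_lt (by linarith) hv]
        congr 1
        rw [sub_add_cancel, neg_div_neg_eq]

lemma HIGH (f : SchwartzMap (EE d) ℂ) {c p r : ℝ} (hc : 0 < c) (hr : 0 < r) (hpr : r < p) :
    ∫⁻ t in Ioi (0:ℝ), ENNReal.ofReal (t ^ (p - r - 1)) *
      ∫⁻ x, ‖f x‖ₑ ^ r * (if c * t < ‖f x‖ then 1 else 0) ≤
      ENNReal.ofReal ((c ^ (p - r) * (p - r))⁻¹) * ∫⁻ x, ‖f x‖ₑ ^ p := by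
  have hf := f.continuous
  have hm : Measurable (fun q : ℝ × EE d => ENNReal.ofReal (q.1 ^ (p - r - 1)) *
      (‖f q.2‖ₑ ^ r * (if c * q.1 < ‖f q.2‖ then (1 : ℝ≥0∞) else 0))) := by
    refine Measurable.mul (by fun_prop)
      (Measurable.mul ((hf.measurable.comp measurable_snd).enorm.pow_const _) ?_)
    refine Measurable.ite ?_ measurable_const measurable_const
    exact (isOpen_lt (by fun_prop) (by fun_prop)).measurableSet
  calc _ = ∫⁻ t in Ioi (0:ℝ), ∫⁻ x, ENNReal.ofReal (t ^ (p - r - 1)) *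
      (‖f x‖ₑ ^ r * (if c * t < ‖f x‖ then 1 else 0)) := by
        simp_rw [lintegral_const_mul' _ _ ENNReal.ofReal_ne_top]
    _ = ∫⁻ x, ∫⁻ t in Ioi (0:ℝ), ENNReal.ofReal (t ^ (p - r - 1)) *
      (‖f x‖ₑ ^ r * (if c * t < ‖f x‖ then 1 else 0)) := lintegral_lintegral_swap hm.aemeasurable
    _ ≤ ∫⁻ x, ENNReal.ofReal ((c ^ (p - r) * (p - r))⁻¹) * ‖f x‖ₑ ^ p := by
        refine lintegral_mono fun x => ?_
        have hfin : ‖f x‖ₑ ^ r ≠ ⊤ := ENNReal.rpow_ne_top_of_nonneg hr.le enorm_ne_top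
        simp_rw [mul_left_comm _ (‖f x‖ₑ ^ r)]
        rw [lintegral_const_mul' _ _ hfin]
        refine (mul_le_mul_right (high_int (norm_nonneg _) hc (by linarith)) _).trans (le_of_eq ?_)
        have hpr' : 0 < p - r := by linarith
        rw [← ofReal_norm, ENNReal.ofReal_rpow_of_nonneg (norm_nonneg _) hr.le,
          ENNReal.ofReal_rpow_of_nonneg (norm_nonneg _) (by linarith),
          ← ENNReal.ofReal_mul (by positivity), ← ENNReal.ofReal_mul (by positivity)]
        congr 1
        have : ‖f x‖ ^ p = ‖f x‖ ^ r * ‖f x‖ ^ (p - r) := by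
          rw [← Real.rpow_add_of_nonneg (norm_nonneg _) hr.le hpr'.le]; congr 1; ring
        rw [this, Real.div_rpow (norm_nonneg _) hc.le]
        field_simp
    _ = _ := by rw [lintegral_const_mul' _ _ ENNReal.ofReal_ne_top]

lemma LOW (f : SchwartzMap (EE d) ℂ) {c p r : ℝ} (hc : 0 < c) (hp : 0 < p) (hpr : p < r) :
    ∫⁻ t in Ioi (0:ℝ), ENNReal.ofReal (t ^ (p - r - 1)) *
      ∫⁻ x, ‖f x‖ₑ ^ r * (if ‖f x‖ ≤ c * t then 1 else 0) ≤
      ENNReal.ofReal (c ^ (r - p) / (r - p)) * ∫⁻ x, ‖f x‖ₑ ^ p := by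
  have hf := f.continuous
  have hr : 0 < r := hp.trans hpr
  have hm : Measurable (fun q : ℝ × EE d => ENNReal.ofReal (q.1 ^ (p - r - 1)) *
      (‖f q.2‖ₑ ^ r * (if ‖f q.2‖ ≤ c * q.1 then (1 : ℝ≥0∞) else 0))) := by
    refine Measurable.mul (by fun_prop)
      (Measurable.mul ((hf.measurable.comp measurable_snd).enorm.pow_const _) ?_)
    refine Measurable.ite ?_ measurable_const measurable_const
    exact (isClosed_le (by fun_prop) (by fun_prop)).measurableSet
  calc _ = ∫⁻ t in Ioi (0:ℝ), ∫⁻ x, ENNReal.ofReal (t ^ (p - r - 1)) *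
      (‖f x‖ₑ ^ r * (if ‖f x‖ ≤ c * t then 1 else 0)) := by
        simp_rw [lintegral_const_mul' _ _ ENNReal.ofReal_ne_top]
    _ = ∫⁻ x, ∫⁻ t in Ioi (0:ℝ), ENNReal.ofReal (t ^ (p - r - 1)) *
      (‖f x‖ₑ ^ r * (if ‖f x‖ ≤ c * t then 1 else 0)) := lintegral_lintegral_swap hm.aemeasurable
    _ ≤ ∫⁻ x, ENNReal.ofReal (c ^ (r - p) / (r - p)) * ‖f x‖ₑ ^ p := by
        refine lintegral_mono fun x => ?_
        have hfin : ‖f x‖ₑ ^ r ≠ ⊤ := ENNReal.rpow_ne_top_of_nonneg hr.le enorm_ne_top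
        simp_rw [mul_left_comm _ (‖f x‖ₑ ^ r)]
        rw [lintegral_const_mul' _ _ hfin]
        rcases eq_or_ne (f x) 0 with h0 | h0
        · rw [h0, enorm_zero, ENNReal.zero_rpow_of_pos hr, zero_mul]; exact bot_le
        have hn : 0 < ‖f x‖ := norm_pos_iff.2 h0
        have hpr' : 0 < r - p := by linarith
        have e : p - r - 1 = -(r - p) - 1 := by ring
        rw [e]
        refine (mul_le_mul_right (low_int hn hc hpr') _).trans (le_of_eq ?_)
        rw [← ofReal_norm, ENNReal.ofReal_rpow_of_nonneg (norm_nonneg _) hr.le,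
          ENNReal.ofReal_rpow_of_nonneg (norm_nonneg _) hp.le,
          ← ENNReal.ofReal_mul (by positivity), ← ENNReal.ofReal_mul (by positivity)]
        congr 1
        have : ‖f x‖ ^ p = ‖f x‖ ^ r * ‖f x‖ ^ (-(r - p)) := by
          rw [← Real.rpow_add hn]; congr 1; ring
        rw [this, Real.div_rpow (norm_nonneg _) hc.le, Real.rpow_neg hc.le]
        field_simp
    _ = _ := by rw [lintegral_const_mul' _ _ ENNReal.ofReal_ne_top]

/-- Weak-type estimate for the part of `f` above height `κ`. -/
lemma weak_high {T : SchwartzMap (EE d) ℂ → EE d → ℝ≥0∞} {W r : ℝ} (hr : 0 < r)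
    (hW0 : 0 ≤ W)
    (hW : ∀ (h : SchwartzMap (EE d) ℂ) (t : ℝ), 0 < t →
      volume {x | ENNReal.ofReal t < T h x} ≤ ENNReal.ofReal (W * t ^ (-r)) * ∫⁻ x, ‖h x‖ₑ ^ r)
    (f h : SchwartzMap (EE d) ℂ) (P : EE d → Prop) [DecidablePred P]
    (hh : ∀ x, ‖h x‖ ≤ ‖f x‖ ∧ (¬ P x → h x = 0)) {t : ℝ} (ht : 0 < t) :
    volume {x | ENNReal.ofReal (t/2) < T h x} ≤
      ENNReal.ofReal (W * 2 ^ r) * (ENNReal.ofReal (t ^ (-r)) *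
        ∫⁻ x, ‖f x‖ₑ ^ r * (if P x then 1 else 0)) := by
  refine (hW h (t/2) (by positivity)).trans ?_
  rw [← mul_assoc, ← ENNReal.ofReal_mul (by positivity)]
  have e : W * (t/2) ^ (-r) = W * 2 ^ r * t ^ (-r) := by
    rw [Real.div_rpow ht.le (by norm_num), Real.rpow_neg (by norm_num : (0:ℝ) ≤ 2)]
    field_simp
  rw [e]
  gcongr with x
  by_cases hP : P x
  · rw [if_pos hP, mul_one]
    refine ENNReal.rpow_le_rpow ?_ hr.le
    rw [← ofReal_norm, ← ofReal_norm]
    exact ENNReal.ofReal_le_ofReal (hh x).1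
  · rw [(hh x).2 hP, enorm_zero, ENNReal.zero_rpow_of_pos hr]; exact bot_le

lemma rpow_combine {t p r : ℝ} (ht : 0 < t) :
    ENNReal.ofReal (t ^ (-r)) * ENNReal.ofReal (t ^ (p - 1)) = ENNReal.ofReal (t ^ (p - r - 1)) := by
  rw [← ENNReal.ofReal_mul (by positivity), ← Real.rpow_add ht]
  congr 2; ring

lemma marc_inf {T : SchwartzMap (EE d) ℂ → EE d → ℝ≥0∞} {W B p r : ℝ} (hr : 0 < r) (hpr : r < p)
    (hW0 : 0 ≤ W) (hB : 0 < B)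
    (hmeas : ∀ f, Measurable (T f)) (hfin : ∀ f x, T f x ≠ ⊤)
    (hsub : ∀ f g x, T (f + g) x ≤ T f x + T g x)
    (hW : ∀ (h : SchwartzMap (EE d) ℂ) (t : ℝ), 0 < t →
      volume {x | ENNReal.ofReal t < T h x} ≤ ENNReal.ofReal (W * t ^ (-r)) * ∫⁻ x, ‖h x‖ₑ ^ r)
    (hInf : ∀ (h : SchwartzMap (EE d) ℂ) (M : ℝ≥0∞), (∀ y, ‖h y‖ₑ ≤ M) →
      ∀ x, T h x ≤ ENNReal.ofReal B * M) (f : SchwartzMap (EE d) ℂ) :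
    ∫⁻ x, T f x ^ p ≤ ENNReal.ofReal (p * (W * 2 ^ r) * (((4 * B)⁻¹) ^ (p - r) * (p - r))⁻¹) *
      ∫⁻ x, ‖f x‖ₑ ^ p := by
  set c : ℝ := (4 * B)⁻¹ with hc
  have hc0 : 0 < c := by positivity
  have hpr' : 0 < p - r := by linarith
  have hp : 0 < p := by linarith
  rw [layer (hmeas f) (hfin f) hp]
  have key : ∀ t : ℝ, 0 < t → volume {x | ENNReal.ofReal t < T f x} ≤
      ENNReal.ofReal (W * 2 ^ r) * (ENNReal.ofReal (t ^ (-r)) *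
        ∫⁻ x, ‖f x‖ₑ ^ r * (if c * t < ‖f x‖ then 1 else 0)) := by
    intro t ht
    obtain ⟨g, h, hfgh, hg, hh⟩ := schwartz_trunc f (mul_pos hc0 ht)
    refine le_trans (measure_mono ?_) (weak_high hr hW0 hW f h (fun x => c * t < ‖f x‖)
      (fun x => ⟨(hh x).1, fun hx => (hh x).2 (not_lt.1 hx)⟩) ht)
    intro x hx
    simp only [mem_ofPred_eq] at hx ⊢
    have h1 : T g x ≤ ENNReal.ofReal (t/2) := by
      refine (hInf g (ENNReal.ofReal (2 * (c * t))) (fun y => ?_) x).trans (le_of_eq ?_)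
      · rw [← ofReal_norm]
        apply ENNReal.ofReal_le_ofReal
        rcases le_or_gt ‖f y‖ (2 * (c * t)) with h | h
        · exact (hg y).1.trans h
        · rw [(hg y).2 h, norm_zero]; positivity
      · rw [← ENNReal.ofReal_mul hB.le]; congr 1; rw [hc]; field_simp; norm_num
    by_contra hcon
    have h2 : T f x ≤ ENNReal.ofReal t := by
      rw [hfgh]
      refine (hsub g h x).trans ((add_le_add h1 (not_lt.1 hcon)).trans (le_of_eq ?_))
      rw [← ENNReal.ofReal_add (by positivity) (by positivity)]; congr 1; ring
    exact absurd hx (not_lt.2 h2)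
  calc _ ≤ ENNReal.ofReal p * ∫⁻ t in Ioi (0:ℝ), ENNReal.ofReal (W * 2 ^ r) *
        (ENNReal.ofReal (t ^ (p - r - 1)) *
          ∫⁻ x, ‖f x‖ₑ ^ r * (if c * t < ‖f x‖ then 1 else 0)) := by
        refine mul_le_mul_right ?_ _
        refine setLIntegral_mono' measurableSet_Ioi fun t ht => ?_
        refine (mul_le_mul_left (key t ht) _).trans (le_of_eq ?_)
        rw [← rpow_combine ht]; ring
    _ ≤ _ := by
        rw [lintegral_const_mul' _ _ ENNReal.ofReal_ne_top]
        refine (mul_le_mul_right (mul_le_mul_right (HIGH f hc0 hr hpr) _) _).trans (le_of_eq ?_)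
        rw [← mul_assoc, ← mul_assoc, ← ENNReal.ofReal_mul hp.le,
          ← ENNReal.ofReal_mul (by positivity)]

lemma marc_12 {T : SchwartzMap (EE d) ℂ → EE d → ℝ≥0∞} {A1 A2 p c : ℝ} (hp1 : 1 < p) (hp2 : p < 2)
    (hA1 : 0 ≤ A1) (hA2 : 0 ≤ A2) (hc : 0 < c)
    (hmeas : ∀ f, Measurable (T f)) (hfin : ∀ f x, T f x ≠ ⊤)
    (hsub : ∀ f g x, T (f + g) x ≤ T f x + T g x)
    (hW1 : ∀ (h : SchwartzMap (EE d) ℂ) (t : ℝ), 0 < t →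
      volume {x | ENNReal.ofReal t < T h x} ≤
        ENNReal.ofReal (A1 * t ^ (-1 : ℝ)) * ∫⁻ x, ‖h x‖ₑ ^ (1:ℝ))
    (hW2 : ∀ (h : SchwartzMap (EE d) ℂ) (t : ℝ), 0 < t →
      volume {x | ENNReal.ofReal t < T h x} ≤
        ENNReal.ofReal (A2 * t ^ (-2 : ℝ)) * ∫⁻ x, ‖h x‖ₑ ^ (2:ℝ))
    (f : SchwartzMap (EE d) ℂ) :
    ∫⁻ x, T f x ^ p ≤ ENNReal.ofReal (p * (A1 * 2 ^ (1:ℝ) * (c ^ (p - 1) * (p - 1))⁻¹ +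
      A2 * 2 ^ (2:ℝ) * ((2 * c) ^ (2 - p) / (2 - p)))) * ∫⁻ x, ‖f x‖ₑ ^ p := by
  have hp : 0 < p := by linarith
  have hp1' : 0 < p - 1 := by linarith
  have hp2' : 0 < 2 - p := by linarith
  have hf := f.continuous
  rw [layer (hmeas f) (hfin f) hp]
  have key : ∀ t : ℝ, 0 < t → volume {x | ENNReal.ofReal t < T f x} ≤
      ENNReal.ofReal (A1 * 2 ^ (1:ℝ)) * (ENNReal.ofReal (t ^ (-1:ℝ)) *
        ∫⁻ x, ‖f x‖ₑ ^ (1:ℝ) * (if c * t < ‖f x‖ then 1 else 0)) +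
      ENNReal.ofReal (A2 * 2 ^ (2:ℝ)) * (ENNReal.ofReal (t ^ (-2:ℝ)) *
        ∫⁻ x, ‖f x‖ₑ ^ (2:ℝ) * (if ‖f x‖ ≤ 2 * c * t then 1 else 0)) := by
    intro t ht
    obtain ⟨g, h, hfgh, hg, hh⟩ := schwartz_trunc f (mul_pos hc ht)
    refine le_trans ((measure_mono ?_).trans (measure_union_le _ _))
      (add_le_add (weak_high one_pos hA1 hW1 f h (fun x => c * t < ‖f x‖)
      (fun x => ⟨(hh x).1, fun hx => (hh x).2 (not_lt.1 hx)⟩) ht)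
      (weak_high two_pos hA2 hW2 f g (fun x => ‖f x‖ ≤ 2 * c * t)
      (fun x => ⟨(hg x).1, fun hx => (hg x).2 (by rw [← mul_assoc]; exact not_le.1 hx)⟩) ht))
    intro x hx
    simp only [mem_ofPred_eq, mem_union] at hx ⊢
    by_contra! hcon
    have h2 : T f x ≤ ENNReal.ofReal t := by
      rw [hfgh]
      refine (hsub g h x).trans ((add_le_add hcon.2 hcon.1).trans (le_of_eq ?_))
      rw [← ENNReal.ofReal_add (by positivity) (by positivity)]; congr 1; ring
    exact absurd hx (not_lt.2 h2)
  have hmH : Measurable (fun t : ℝ => ENNReal.ofReal (A1 * 2 ^ (1:ℝ)) *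
        (ENNReal.ofReal (t ^ (p - 1 - 1)) *
          ∫⁻ x, ‖f x‖ₑ ^ (1:ℝ) * (if c * t < ‖f x‖ then 1 else 0))) := by
    refine Measurable.const_mul (Measurable.mul (by fun_prop) ?_) _
    refine Measurable.lintegral_prod_right' (f := fun q : ℝ × EE d =>
      ‖f q.2‖ₑ ^ (1:ℝ) * (if c * q.1 < ‖f q.2‖ then (1 : ℝ≥0∞) else 0)) ?_
    refine Measurable.mul ((hf.measurable.comp measurable_snd).enorm.pow_const _) ?_
    refine Measurable.ite ?_ measurable_const measurable_const
    exact (isOpen_lt (by fun_prop) (by fun_prop)).measurableSet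
  calc _ ≤ ENNReal.ofReal p * ∫⁻ t in Ioi (0:ℝ), (ENNReal.ofReal (A1 * 2 ^ (1:ℝ)) *
        (ENNReal.ofReal (t ^ (p - 1 - 1)) *
          ∫⁻ x, ‖f x‖ₑ ^ (1:ℝ) * (if c * t < ‖f x‖ then 1 else 0)) +
        ENNReal.ofReal (A2 * 2 ^ (2:ℝ)) *
        (ENNReal.ofReal (t ^ (p - 2 - 1)) *
          ∫⁻ x, ‖f x‖ₑ ^ (2:ℝ) * (if ‖f x‖ ≤ 2 * c * t then 1 else 0))) := by
        refine mul_le_mul_right ?_ _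
        refine setLIntegral_mono' measurableSet_Ioi fun t ht => ?_
        refine (mul_le_mul_left (key t ht) _).trans (le_of_eq ?_)
        rw [← rpow_combine ht, ← rpow_combine ht]; ring
    _ ≤ _ := by
        rw [lintegral_add_left hmH, lintegral_const_mul' _ _ ENNReal.ofReal_ne_top,
          lintegral_const_mul' _ _ ENNReal.ofReal_ne_top]
        refine (mul_le_mul_right (add_le_add
          (mul_le_mul_right (HIGH f hc one_pos hp1) _)
          (mul_le_mul_right (LOW f (by positivity : 0 < 2 * c) hp hp2) _)) _).trans (le_of_eq ?_)
        rw [← mul_assoc, ← mul_assoc, ← add_mul, ← mul_assoc, ← ENNReal.ofReal_mul (by positivity),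
          ← ENNReal.ofReal_mul (by positivity), ← ENNReal.ofReal_add (by positivity) (by positivity),
          ← ENNReal.ofReal_mul hp.le]


lemma multStar_measurable {m : EE d → ℂ} (hm : Continuous m) {α : ℝ} (hα : ∀ ξ, ‖m ξ‖ ≤ α)
    (f : SchwartzMap (EE d) ℂ) : Measurable (multStar m f) := by
  have h1 : LowerSemicontinuous (multStar m f) := by
    refine lowerSemicontinuous_iSup fun t => Continuous.lowerSemicontinuous ?_
    have := (mult_continuous hm hα f).comp (Continuous.prodMk_right (t : ℝ))
    exact this.enorm
  exact h1.measurable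

lemma multStar_fin {m : EE d → ℂ} {α : ℝ} (hα : ∀ ξ, ‖m ξ‖ ≤ α)
    (f : SchwartzMap (EE d) ℂ) (x : EE d) : multStar m f x ≠ ⊤ := by
  have hI : Integrable (fun ξ => α * ‖𝓕 f ξ‖) := (𝓕 f).integrable.norm.const_mul α
  refine ne_top_of_le_ne_top (b := ENNReal.ofReal (∫ ξ, α * ‖𝓕 f ξ‖)) ENNReal.ofReal_ne_top
    (iSup_le fun t => ?_)
  rw [← ofReal_norm]
  apply ENNReal.ofReal_le_ofReal
  unfold mult
  refine norm_integral_le_of_norm_le hI (Filter.Eventually.of_forall fun ξ => ?_)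
  rw [norm_mul, norm_ec, one_mul, norm_mul]
  gcongr
  exact hα _

lemma mult_add {m : EE d → ℂ} (hm : Continuous m) {α : ℝ} (hα : ∀ ξ, ‖m ξ‖ ≤ α)
    (f g : SchwartzMap (EE d) ℂ) (t : ℝ) (x : EE d) :
    mult m t (f + g) x = mult m t f x + mult m t g x := by
  unfold mult
  rw [← integral_add (mult_integrable' hm hα t f x) (mult_integrable' hm hα t g x)]
  congr 1; ext ξ
  rw [FourierTransform.fourier_add]
  show _ * (_ * (𝓕 f ξ + 𝓕 g ξ)) = _
  ring

lemma multStar_add {m : EE d → ℂ} (hm : Continuous m) {α : ℝ} (hα : ∀ ξ, ‖m ξ‖ ≤ α)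
    (f g : SchwartzMap (EE d) ℂ) (x : EE d) :
    multStar m (f + g) x ≤ multStar m f x + multStar m g x := by
  refine iSup_le fun t => ?_
  rw [mult_add hm hα]
  refine (enorm_add_le _ _).trans (add_le_add ?_ ?_)
  · exact le_iSup (fun t : {t : ℝ // 0 < t} => ‖mult m t f x‖ₑ) t
  · exact le_iSup (fun t : {t : ℝ // 0 < t} => ‖mult m t g x‖ₑ) t

lemma mult_mT_eq (μ : Measure (EE d)) [IsFiniteMeasure μ] (j : ℕ) (f : SchwartzMap (EE d) ℂ)
    (t : ℝ) (x : EE d) :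
    mult (mT μ j) t f x = mult (mA μ (j+1)) t f x - mult (mA μ j) t f x := by
  unfold mult
  rw [← integral_sub (mult_integrable' (mA_continuous μ _) (mA_bdd μ _) t f x)
    (mult_integrable' (mA_continuous μ _) (mA_bdd μ _) t f x)]
  congr 1; ext ξ
  rw [mT_eq]; ring

lemma multStar_mT_le (μ : Measure (EE d)) [IsFiniteMeasure μ] (j : ℕ) (f : SchwartzMap (EE d) ℂ)
    (x : EE d) : multStar (mT μ j) f x ≤ multStar (mA μ (j+1)) f x + multStar (mA μ j) f x := by
  refine iSup_le fun t => ?_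
  rw [mult_mT_eq]
  refine enorm_sub_le.trans (add_le_add ?_ ?_)
  · exact le_iSup (fun t : {t : ℝ // 0 < t} => ‖mult (mA μ (j+1)) t f x‖ₑ) t
  · exact le_iSup (fun t : {t : ℝ // 0 < t} => ‖mult (mA μ j) t f x‖ₑ) t

lemma weak_of_HL {K : ℝ} (hK : 0 < K) (hHL : ∀ (g : EE d → ℝ≥0∞) (l : ℝ), 0 < l →
    volume {x | ENNReal.ofReal l < HL g x} ≤ ENNReal.ofReal (K / l) * ∫⁻ x, g x)
    {T : SchwartzMap (EE d) ℂ → EE d → ℝ≥0∞} {Q : ℝ} (hQ : 0 < Q)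
    (hT : ∀ f x, T f x ≤ ENNReal.ofReal Q * HL (fun x => ‖f x‖ₑ) x)
    (h : SchwartzMap (EE d) ℂ) (t : ℝ) (ht : 0 < t) :
    volume {x | ENNReal.ofReal t < T h x} ≤
      ENNReal.ofReal (K * Q * t ^ (-1 : ℝ)) * ∫⁻ x, ‖h x‖ₑ ^ (1:ℝ) := by
  have h1 := hHL (fun x => ‖h x‖ₑ) (t / Q) (by positivity)
  have e : K * Q * t ^ (-1 : ℝ) = K / (t / Q) := by
    rw [Real.rpow_neg_one]; field_simp
  rw [e]
  simp only [ENNReal.rpow_one]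
  refine le_trans (measure_mono fun x hx => ?_) h1
  simp only [mem_ofPred_eq] at hx ⊢
  by_contra hcon
  have h2 : T h x ≤ ENNReal.ofReal t := by
    refine (hT h x).trans ((mul_le_mul_right (not_lt.1 hcon) _).trans (le_of_eq ?_))
    rw [← ENNReal.ofReal_mul hQ.le]; congr 1; field_simp
  exact absurd hx (not_lt.2 h2)

lemma weak_of_L2 {T : SchwartzMap (EE d) ℂ → EE d → ℝ≥0∞} {Q : ℝ} (hQ : 0 ≤ Q)
    (hmeas : ∀ f, Measurable (T f))
    (hT : ∀ f, ∫⁻ x, T f x ^ 2 ≤ ENNReal.ofReal Q * ∫⁻ x, ‖f x‖ₑ ^ 2)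
    (h : SchwartzMap (EE d) ℂ) (t : ℝ) (ht : 0 < t) :
    volume {x | ENNReal.ofReal t < T h x} ≤
      ENNReal.ofReal (Q * t ^ (-2 : ℝ)) * ∫⁻ x, ‖h x‖ₑ ^ (2:ℝ) := by
  have e2 : ∫⁻ x, ‖h x‖ₑ ^ (2:ℝ) = ∫⁻ x, ‖h x‖ₑ ^ 2 := by simp_rw [ENNReal.rpow_two]
  rw [e2]
  have h0 : ENNReal.ofReal (t ^ 2) ≠ 0 := by
    simp only [ne_eq, ENNReal.ofReal_eq_zero, not_le]; positivity
  have h1 := meas_ge_le_lintegral_div (μ := volume) ((hmeas h).pow_const 2).aemeasurable h0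
    ENNReal.ofReal_ne_top
  refine (measure_mono fun x hx => ?_).trans (h1.trans ?_)
  · simp only [mem_ofPred_eq] at hx ⊢
    rw [ENNReal.ofReal_pow ht.le]
    exact pow_le_pow_left₀ bot_le hx.le 2
  · rw [ENNReal.div_eq_inv_mul]
    refine (mul_le_mul_right (hT h) _).trans (le_of_eq ?_)
    rw [← mul_assoc, ← ENNReal.ofReal_inv_of_pos (by positivity),
      ← ENNReal.ofReal_mul (by positivity)]
    congr 2
    rw [Real.rpow_neg ht.le, Real.rpow_two, mul_comm]

lemma mA_Lp (μ : Measure (EE d)) [IsFiniteMeasure μ] (hd : 1 ≤ d) {b C4 R : ℝ} (hC4 : 0 < C4)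
    (hb : b ≤ d)
    (hfro : ∀ (x : EE d) (r : ℝ), 0 < r → μ (ball x r) ≤ ENNReal.ofReal (C4 * r ^ b))
    (hR : 0 < R) (hsupp : ∀ᵐ y ∂μ, ‖y‖ ≤ R) {p : ℝ} (hp : 1 < p) :
    ∃ C : ℝ, 0 < C ∧ ∀ f : SchwartzMap (EE d) ℂ,
      ∫⁻ x, multStar (mA μ 0) f x ^ p ≤ ENNReal.ofReal C * ∫⁻ x, ‖f x‖ₑ ^ p := by
  obtain ⟨KH, hKH, hHL⟩ := HL_weak hd
  obtain ⟨K, hK, hmA⟩ := multStar_mA_HL μ hC4 hb hfro hR hsupp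
  obtain ⟨B, hB, hInf⟩ := multStar_mA_Linf μ
  have hp1 : 0 < p - 1 := by linarith
  have hQ : 0 < K * ((2:ℝ)^0) ^ ((d:ℝ) - b) := by positivity
  have := marc_inf (T := multStar (mA μ 0)) (p := p) one_pos hp (by positivity) hB
    (multStar_measurable (mA_continuous μ 0) (mA_bdd μ 0)) (multStar_fin (mA_bdd μ 0))
    (multStar_add (mA_continuous μ 0) (mA_bdd μ 0))
    (weak_of_HL hKH hHL hQ (hmA 0)) (hInf 0)
  exact ⟨_, by positivity, this⟩

lemma mT_Lp (μ : Measure (EE d)) [IsFiniteMeasure μ] (hd : 1 ≤ d) {a b C1 C4 R : ℝ}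
    (ha : 1/2 < a) (hC1 : 0 < C1)
    (hdecay : ∀ ξ : EE d, ‖mFT μ ξ‖ ≤ C1 * (1 + ‖ξ‖) ^ (-a))
    (hC4 : 0 < C4) (hb : b ≤ d)
    (hfro : ∀ (x : EE d) (r : ℝ), 0 < r → μ (ball x r) ≤ ENNReal.ofReal (C4 * r ^ b))
    (hR : 0 < R) (hsupp : ∀ᵐ y ∂μ, ‖y‖ ≤ R) {p : ℝ}
    (hp : (2*((d:ℝ)-b)+2*a-1)/((d:ℝ)-b+2*a-1) < p) :
    ∃ C γ : ℝ, 0 < C ∧ γ < 0 ∧ ∀ (j : ℕ) (f : SchwartzMap (EE d) ℂ),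
      ∫⁻ x, multStar (mT μ j) f x ^ p ≤ ENNReal.ofReal (C * ((2:ℝ)^j) ^ γ) * ∫⁻ x, ‖f x‖ₑ ^ p := by
  obtain ⟨KH, hKH, hHL⟩ := HL_weak hd
  obtain ⟨K, hK, hmA⟩ := multStar_mA_HL μ hC4 hb hfro hR hsupp
  obtain ⟨B, hB, hInf⟩ := multStar_mA_Linf μ
  obtain ⟨C3, hC3, hL2⟩ := mT_L2 μ hd (by linarith : 0 < a) hC1 hdecay hR hsupp
  set D : ℝ := (d:ℝ) - b with hD
  have hD0 : 0 ≤ D := by linarith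
  have hp' : 2 * D + (2*a-1) < p * (D + (2*a-1)) := by
    rw [div_lt_iff₀ (by linarith)] at hp
    nlinarith
  have hp1 : 1 < p := by
    by_contra h
    nlinarith
  have hmT : ∀ (j : ℕ) f x, multStar (mT μ j) f x ≤
      ENNReal.ofReal (K * (2 ^ D + 1) * ((2:ℝ)^j) ^ D) * HL (fun x => ‖f x‖ₑ) x := by
    intro j f x
    refine (multStar_mT_le μ j f x).trans ((add_le_add (hmA (j+1) f x) (hmA j f x)).trans
      (le_of_eq ?_))
    rw [← add_mul, ← ENNReal.ofReal_add (by positivity) (by positivity)]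
    congr 2
    rw [pow_succ, Real.mul_rpow (by positivity) (by norm_num)]; ring
  have hmeas := fun j => multStar_measurable (mT_continuous μ j) (mT_bdd μ j)
  have hfin := fun j => multStar_fin (mT_bdd μ j)
  have hadd := fun j => multStar_add (mT_continuous μ j) (mT_bdd μ j)
  have hW2 := fun j => weak_of_L2 (by positivity) (hmeas j) (hL2 j)
  rcases lt_trichotomy p 2 with h2 | h2 | h2
  · have hW1 := fun j => weak_of_HL hKH hHL (by positivity) (hmT j)
    have hp1' : 0 < p - 1 := by linarith
    have hp2' : 0 < 2 - p := by linarith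
    refine ⟨p * (KH * (K * (2 ^ D + 1)) * 2 ^ (1:ℝ) * (p - 1)⁻¹ +
      C3 * 2 ^ (2:ℝ) * (2 ^ (2 - p) / (2 - p))), D * (2 - p) - (2*a-1) * (p - 1), by positivity,
      by nlinarith, fun j f => ?_⟩
    have hρ : (0:ℝ) < 2^j := by positivity
    set ρ : ℝ := 2^j
    refine (marc_12 (c := ρ ^ (D + (2*a-1))) hp1 h2 (by positivity) (by positivity) (by positivity)
      (hmeas j) (hfin j) (hadd j) (hW1 j) (hW2 j) f).trans (le_of_eq ?_)
    congr 2
    have e1 : (ρ ^ (D + (2*a-1))) ^ (p - 1) = ρ ^ ((D + (2*a-1)) * (p-1)) :=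
      (Real.rpow_mul hρ.le _ _).symm
    have e2 : (2 * ρ ^ (D + (2*a-1))) ^ (2 - p) = 2 ^ (2 - p) * ρ ^ ((D + (2*a-1)) * (2 - p)) := by
      rw [Real.mul_rpow (by norm_num) (by positivity), ← Real.rpow_mul hρ.le]
    have e3 : ρ ^ (D * (2 - p) - (2*a-1) * (p - 1)) = ρ ^ D * (ρ ^ ((D + (2*a-1)) * (p-1)))⁻¹ := by
      rw [← Real.rpow_neg hρ.le, ← Real.rpow_add hρ]; congr 1; ring
    have e4 : ρ ^ (D * (2 - p) - (2*a-1) * (p - 1)) =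
        ρ ^ (1 - 2*a) * ρ ^ ((D + (2*a-1)) * (2 - p)) := by
      rw [← Real.rpow_add hρ]; congr 1; ring
    rw [e1, e2, mul_assoc p _ (ρ ^ (D * (2 - p) - (2*a-1) * (p - 1)))]
    have f1 : KH * (K * (2 ^ D + 1) * ρ ^ D) * 2 ^ (1:ℝ) *
        (ρ ^ ((D + (2*a-1)) * (p-1)) * (p - 1))⁻¹ =
        KH * (K * (2 ^ D + 1)) * 2 ^ (1:ℝ) * (p - 1)⁻¹ *
          ρ ^ (D * (2 - p) - (2*a-1) * (p - 1)) := by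
      rw [e3, mul_inv]; ring
    have f2 : C3 * ρ ^ (1 - 2*a) * 2 ^ (2:ℝ) *
        (2 ^ (2 - p) * ρ ^ ((D + (2*a-1)) * (2 - p)) / (2 - p)) =
        C3 * 2 ^ (2:ℝ) * (2 ^ (2 - p) / (2 - p)) *
          ρ ^ (D * (2 - p) - (2*a-1) * (p - 1)) := by
      rw [e4]; ring
    refine congrArg (fun z => p * z) ?_
    refine Eq.trans ?_ (add_mul _ _ _).symm
    exact congrArg₂ (fun z w => z + w) f1 f2
  · refine ⟨C3, 1 - 2 * a, hC3, by linarith, fun j f => ?_⟩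
    subst h2
    simpa only [ENNReal.rpow_two] using hL2 j f
  · have hInf' : ∀ (j : ℕ) (h : SchwartzMap (EE d) ℂ) (M : ℝ≥0∞), (∀ y, ‖h y‖ₑ ≤ M) →
        ∀ x, multStar (mT μ j) h x ≤ ENNReal.ofReal (2 * B) * M := by
      intro j h M hM x
      refine (multStar_mT_le μ j h x).trans ((add_le_add (hInf (j+1) h M hM x)
        (hInf j h M hM x)).trans (le_of_eq ?_))
      rw [← add_mul, ← ENNReal.ofReal_add hB.le hB.le]; congr 2; ring
    have hp2' : 0 < p - 2 := by linarith
    refine ⟨p * (C3 * 2 ^ (2:ℝ)) * (((4 * (2 * B))⁻¹) ^ (p - 2) * (p - 2))⁻¹, 1 - 2 * a,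
      by positivity, by linarith, fun j f => ?_⟩
    refine (marc_inf two_pos h2 (by positivity) (by positivity) (hmeas j) (hfin j) (hadd j) (hW2 j)
      (hInf' j) f).trans (le_of_eq ?_)
    congr 2
    ring

open Filter Topology in
lemma convM_limit (μ : Measure (EE d)) [IsFiniteMeasure μ] (f : SchwartzMap (EE d) ℂ) (t : ℝ)
    (x : EE d) : Tendsto (fun J : ℕ => mult (mA μ J) t f x) atTop (𝓝 (convM f μ t x)) := by
  have hf := f.continuous
  have hφ := (phiS d).continuous
  obtain ⟨K, hK⟩ := schwartz_bdd f
  have h1 : Integrable (fun p : EE d × EE d => (1 : ℂ) * phiS d p.2) (μ.prod volume) :=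
    (integrable_const (1:ℂ)).mul_prod (phiS d).integrable
  simp only [one_mul] at h1
  have hone : ∫ z, phiS d z = 1 := by
    have := bb_eq_integral (0 : EE d)
    rw [bb_one (by simp)] at this
    simpa [ec] using this.symm
  have e : convM f μ t x = ∫ p : EE d × EE d, phiS d p.2 * f (x - t • p.1) ∂(μ.prod volume) := by
    have := integral_prod_mul (μ := μ) (ν := (volume : Measure (EE d)))
      (fun y => f (x - t • y)) (phiS d)
    rw [hone, mul_one] at this
    unfold convM
    rw [← this]
    congr 1; ext p; ring
  rw [e]
  simp_rw [mult_mA_kernel]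
  refine tendsto_integral_of_dominated_convergence (fun p => ‖phiS d p.2‖ * K) ?_
    (h1.norm.mul_const K) ?_ ?_
  · intro J; exact Continuous.aestronglyMeasurable (by fun_prop)
  · intro J; refine Eventually.of_forall fun p => ?_
    rw [norm_mul]; gcongr; exact hK _
  · refine Eventually.of_forall fun p => ?_
    refine Tendsto.const_mul _ ((hf.tendsto _).comp ?_)
    have h0 : Tendsto (fun J : ℕ => ((2:ℝ)^J)⁻¹) atTop (𝓝 0) := by
      have := tendsto_pow_atTop_nhds_zero_of_lt_one (r := (1/2 : ℝ)) (by norm_num) (by norm_num)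
      simpa using this
    have h2 : Tendsto (fun J : ℕ => x - t • (p.1 + ((2:ℝ)^J)⁻¹ • p.2)) atTop
        (𝓝 (x - t • (p.1 + (0:ℝ) • p.2))) :=
      tendsto_const_nhds.sub ((tendsto_const_nhds.add (h0.smul_const p.2)).const_smul t)
    simpa using h2

lemma mult_mA_le_sum (μ : Measure (EE d)) [IsFiniteMeasure μ] (f : SchwartzMap (EE d) ℂ)
    (t : {t : ℝ // 0 < t}) (x : EE d) (J : ℕ) :
    ‖mult (mA μ J) t f x‖ₑ ≤ multStar (mA μ 0) f x +
      ∑ j ∈ Finset.range J, multStar (mT μ j) f x := by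
  induction J with
  | zero =>
    simp only [Finset.range_zero, Finset.sum_empty, add_zero]
    exact le_iSup (fun t : {t : ℝ // 0 < t} => ‖mult (mA μ 0) t f x‖ₑ) t
  | succ J ih =>
    have e : mult (mA μ (J+1)) t f x = mult (mA μ J) t f x + mult (mT μ J) t f x := by
      rw [mult_mT_eq]; ring
    rw [e, Finset.sum_range_succ, ← add_assoc]
    exact (enorm_add_le _ _).trans (add_le_add ih
      (le_iSup (fun t : {t : ℝ // 0 < t} => ‖mult (mT μ J) t f x‖ₑ) t))

lemma Mmax_le (μ : Measure (EE d)) [IsFiniteMeasure μ] (f : SchwartzMap (EE d) ℂ) (x : EE d) :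
    Mmax μ f x ≤ ⨆ J : ℕ, (multStar (mA μ 0) f x +
      ∑ j ∈ Finset.range J, multStar (mT μ j) f x) := by
  refine iSup_le fun t => ?_
  refine le_of_tendsto (convM_limit μ f t x).enorm (Filter.Eventually.of_forall fun J => ?_)
  exact (mult_mA_le_sum μ f t x J).trans (le_iSup (fun J : ℕ => (multStar (mA μ 0) f x +
      ∑ j ∈ Finset.range J, multStar (mT μ j) f x)) J)

lemma partial_Lp {p C0 : ℝ} (hp : 1 < p) {s : ℕ → ℝ} (hC0 : 0 ≤ C0) (hs : ∀ j, 0 ≤ s j)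
    {g0 : EE d → ℝ≥0∞} {g : ℕ → EE d → ℝ≥0∞} (hg0 : Measurable g0) (hg : ∀ j, Measurable (g j))
    {F : ℝ≥0∞} (h0 : (∫⁻ x, g0 x ^ p) ^ (1/p) ≤ ENNReal.ofReal C0 * F)
    (h : ∀ j, (∫⁻ x, g j x ^ p) ^ (1/p) ≤ ENNReal.ofReal (s j) * F) (J : ℕ) :
    (∫⁻ x, (g0 x + ∑ j ∈ Finset.range J, g j x) ^ p) ^ (1/p) ≤
      ENNReal.ofReal (C0 + ∑ j ∈ Finset.range J, s j) * F := by
  induction J with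
  | zero => simpa using h0
  | succ J ih =>
    simp_rw [Finset.sum_range_succ, ← add_assoc]
    have hm : Measurable (fun x => g0 x + ∑ j ∈ Finset.range J, g j x) :=
      hg0.add (Finset.measurable_sum _ fun j _ => hg j)
    have := ENNReal.lintegral_Lp_add_le (μ := volume) hm.aemeasurable (hg J).aemeasurable hp.le
    refine le_trans this ((add_le_add ih (h J)).trans (le_of_eq ?_))
    rw [← add_mul, ← ENNReal.ofReal_add (add_nonneg hC0 (Finset.sum_nonneg fun j _ => hs j)) (hs J)]

lemma rpow_root {p C : ℝ} (hp : 0 < p) (hC : 0 ≤ C) {I G : ℝ≥0∞} (h : G ≤ ENNReal.ofReal C * I) :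
    G ^ (1/p) ≤ ENNReal.ofReal (C ^ (1/p)) * I ^ (1/p) := by
  have hp' : 0 ≤ 1/p := by positivity
  refine (ENNReal.rpow_le_rpow h hp').trans (le_of_eq ?_)
  rw [ENNReal.mul_rpow_of_nonneg _ _ hp', ENNReal.ofReal_rpow_of_nonneg hC hp']


theorem stmt2_aux (d : ℕ) (hd : 1 ≤ d) (μ : Measure (EuclideanSpace ℝ (Fin d)))
    [IsFiniteMeasure μ] (hcomp : ∃ K : Set (EuclideanSpace ℝ (Fin d)), IsCompact K ∧ μ Kᶜ = 0)
    (a b C : ℝ) (ha : 1/2 < a) (hb2 : b ≤ d)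
    (hdecay : ∀ ξ : EuclideanSpace ℝ (Fin d), ξ ≠ 0 → ‖mFT μ ξ‖ ≤ C * ‖ξ‖ ^ (-a))
    (hfrostman : ∀ (x : EuclideanSpace ℝ (Fin d)) (r : ℝ), 0 < r →
      μ (ball x r) ≤ ENNReal.ofReal (C * r ^ b))
    (p : ℝ) (hp : (2*((d:ℝ)-b)+2*a-1)/((d:ℝ)-b+2*a-1) < p) :
    ∃ C' : ℝ, 0 < C' ∧ ∀ f : SchwartzMap (EuclideanSpace ℝ (Fin d)) ℂ,
      lpE (Mmax μ ⇑f) p ≤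
        ENNReal.ofReal C' * (∫⁻ x, (‖f x‖₊ : ℝ≥0∞) ^ p) ^ (1/p) := by
  have hp1 : 1 < p := by
    rw [div_lt_iff₀ (by linarith)] at hp
    by_contra h
    nlinarith
  have hp0 : 0 < p := by linarith
  obtain ⟨K, hKc, hK⟩ := hcomp
  obtain ⟨R0, hR0⟩ := hKc.isBounded.exists_norm_le
  have hsupp : ∀ᵐ y ∂μ, ‖y‖ ≤ max R0 1 := by
    have : ∀ᵐ y ∂μ, y ∈ K := hK
    filter_upwards [this] with y hy
    exact (hR0 y hy).trans (le_max_left _ _)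
  have hR : 0 < max R0 1 := lt_max_of_lt_right one_pos
  obtain ⟨C1, hC1, hdec⟩ := mFT_decay μ (by linarith : 0 < a) hdecay
  have hfro : ∀ (x : EE d) (r : ℝ), 0 < r → μ (ball x r) ≤ ENNReal.ofReal ((|C| + 1) * r ^ b) := by
    intro x r hr
    refine (hfrostman x r hr).trans (ENNReal.ofReal_le_ofReal ?_)
    gcongr
    linarith [le_abs_self C]
  have hC4 : 0 < |C| + 1 := by positivity
  obtain ⟨C0, hC0, hA⟩ := mA_Lp μ hd hC4 hb2 hfro hR hsupp hp1
  obtain ⟨C5, γ, hC5, hγ, hT⟩ := mT_Lp μ hd ha hC1 hdec hC4 hb2 hfro hR hsupp hp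
  set q : ℝ := 2 ^ (γ / p) with hq
  have hq0 : 0 < q := by positivity
  have hq1 : q < 1 := Real.rpow_lt_one_of_one_lt_of_neg (by norm_num) (div_neg_of_neg_of_pos hγ hp0)
  have hs : ∀ j : ℕ, (C5 * ((2:ℝ)^j) ^ γ) ^ (1/p) = C5 ^ (1/p) * q ^ j := by
    intro j
    rw [Real.mul_rpow hC5.le (by positivity), ← Real.rpow_mul (by positivity), hq,
      ← Real.rpow_natCast, ← Real.rpow_natCast, ← Real.rpow_mul (by norm_num),
      ← Real.rpow_mul (by norm_num)]
    congr 2; ring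
  refine ⟨C0 ^ (1/p) + C5 ^ (1/p) * (1 - q)⁻¹, ?_, fun f => ?_⟩
  · have : 0 < 1 - q := by linarith
    positivity
  have eF : ∫⁻ x, (‖f x‖₊ : ℝ≥0∞) ^ p = ∫⁻ x, ‖f x‖ₑ ^ p := rfl
  rw [eF]
  set F := (∫⁻ x, ‖f x‖ₑ ^ p) ^ (1/p)
  have hmA := multStar_measurable (mA_continuous μ 0) (mA_bdd μ 0) f
  have hmT := fun j => multStar_measurable (mT_continuous μ j) (mT_bdd μ j) f
  have hpart : ∀ J : ℕ, (∫⁻ x, (multStar (mA μ 0) f x +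
      ∑ j ∈ Finset.range J, multStar (mT μ j) f x) ^ p) ^ (1/p) ≤
      ENNReal.ofReal (C0 ^ (1/p) + C5 ^ (1/p) * (1 - q)⁻¹) * F := by
    intro J
    refine (partial_Lp hp1 (by positivity) (s := fun j => C5 ^ (1/p) * q ^ j)
      (fun j => by positivity) hmA hmT (F := F) (rpow_root hp0 hC0.le (hA f))
      (fun j => by
        have := rpow_root hp0 (by positivity) (hT j f)
        rw [hs j] at this; exact this) J).trans ?_
    gcongr
    rw [← Finset.mul_sum]
    gcongr
    exact (Summable.sum_le_tsum _ (fun i _ => by positivity)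
      (summable_geometric_of_lt_one hq0.le hq1)).trans (le_of_eq (tsum_geometric_of_lt_one hq0.le hq1))
  have hpart' : ∀ J : ℕ, ∫⁻ x, (multStar (mA μ 0) f x +
      ∑ j ∈ Finset.range J, multStar (mT μ j) f x) ^ p ≤
      (ENNReal.ofReal (C0 ^ (1/p) + C5 ^ (1/p) * (1 - q)⁻¹) * F) ^ p := by
    intro J
    have := ENNReal.rpow_le_rpow (hpart J) hp0.le
    rwa [← ENNReal.rpow_mul, one_div_mul_cancel hp0.ne', ENNReal.rpow_one] at this
  have hmono : Monotone (fun (J : ℕ) (x : EE d) => (multStar (mA μ 0) f x +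
      ∑ j ∈ Finset.range J, multStar (mT μ j) f x) ^ p) := by
    intro J J' hJ x
    refine ENNReal.rpow_le_rpow (add_le_add le_rfl ?_) hp0.le
    exact Finset.sum_le_sum_of_subset (Finset.range_mono hJ)
  have hfinal : ∫⁻ x, Mmax μ f x ^ p ≤
      (ENNReal.ofReal (C0 ^ (1/p) + C5 ^ (1/p) * (1 - q)⁻¹) * F) ^ p := by
    calc ∫⁻ x, Mmax μ f x ^ p ≤ ∫⁻ x, ⨆ J : ℕ, (multStar (mA μ 0) f x +
          ∑ j ∈ Finset.range J, multStar (mT μ j) f x) ^ p := by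
          refine lintegral_mono fun x => ?_
          refine (ENNReal.rpow_le_rpow (Mmax_le μ f x) hp0.le).trans (le_of_eq ?_)
          exact (ENNReal.orderIsoRpow p hp0).map_iSup _
      _ = ⨆ J : ℕ, ∫⁻ x, (multStar (mA μ 0) f x +
          ∑ j ∈ Finset.range J, multStar (mT μ j) f x) ^ p := by
          refine lintegral_iSup (fun J => ?_) hmono
          exact (hmA.add (Finset.measurable_sum _ fun j _ => hmT j)).pow_const p
      _ ≤ _ := iSup_le hpart'
  unfold lpE
  refine (ENNReal.rpow_le_rpow hfinal (by positivity)).trans (le_of_eq ?_)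
  rw [← ENNReal.rpow_mul, mul_one_div_cancel hp0.ne', ENNReal.rpow_one]


/-- Under Fourier decay of order a > 1/2 and the Frostman condition of order b with
d−1 < b ≤ d, the maximal operator M_μ is bounded on L^p for
p > p_{(a,b)} = (2(d−b)+2a−1)/(d−b+2a−1). -/
theorem stmt2 (d : ℕ) (hd : 1 ≤ d) (μ : Measure (EuclideanSpace ℝ (Fin d)))
    [IsFiniteMeasure μ] (hcomp : ∃ K : Set (EuclideanSpace ℝ (Fin d)), IsCompact K ∧ μ Kᶜ = 0)
    (a b C : ℝ) (ha : 1/2 < a) (hb1 : (d:ℝ) - 1 < b) (hb2 : b ≤ d)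
    (hdecay : ∀ ξ : EuclideanSpace ℝ (Fin d), ξ ≠ 0 → ‖mFT μ ξ‖ ≤ C * ‖ξ‖ ^ (-a))
    (hfrostman : ∀ (x : EuclideanSpace ℝ (Fin d)) (r : ℝ), 0 < r →
      μ (ball x r) ≤ ENNReal.ofReal (C * r ^ b))
    (p : ℝ) (hp : (2*((d:ℝ)-b)+2*a-1)/((d:ℝ)-b+2*a-1) < p) :
    ∃ C' : ℝ, 0 < C' ∧ ∀ f : SchwartzMap (EuclideanSpace ℝ (Fin d)) ℂ,
      lpE (Mmax μ ⇑f) p ≤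
        ENNReal.ofReal C' * (∫⁻ x, (‖f x‖₊ : ℝ≥0∞) ^ p) ^ (1/p) := by
  exact stmt2_aux d hd μ hcomp a b C ha hb2 hdecay hfrostman p hp
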